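/- arXiv:2101.03534 — 3 statements merged into one kernel-verified Lean document; each statement's English description precedes it below -/
import Mathlib

section
/- Let n ≥ 1, let B = ℝ^{2n-2} with its standard symplectic form, and let M = ℝ^{2n-2} × (−1,1) × ℝ (an open subset of ℝ^{2n}, with (−1,1) the x_n-coordinate and ℝ the y_n-coordinate). Let C ⊆ ℝ^{2n-2} be closed, let λ : ℝ^{2n-2} → ℝ be smooth with −1 < λ(p) ≤ 1 for all p, and let Z = {(p, x, 0) ∈ M : p ∈ C and λ(p) ≤ x} (a closed subset of M). Then Z is time-independent Hamiltonian excisable from (M, ω_can): there exists a smooth F : M → ℝ such that every forward trajectory of the flow of X_F starting in Z stays in Z as long as it is defined, the maximal integral curve of X_F starting at any z ∈ M ∖ Z is defined at least on [0,1], and the time-1 flow map of X_F is a symplectomorphism from M ∖ Z onto M. -/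
open Set

noncomputable section

/-- `ℝ^{2n}` presented as `(p, xₙ, yₙ)` with `p = (x₁,y₁,…,x_{n-1},y_{n-1}) ∈ ℝ^{2(n-1)}`;
here `m = n - 1`, so `n ≥ 1` corresponds to arbitrary `m : ℕ`. -/
abbrev EE (m : ℕ) := ((Fin m → ℝ) × (Fin m → ℝ)) × ℝ × ℝ

/-- The standard symplectic form on `ℝ^{2m}`. -/
def wB (m : ℕ) (u v : (Fin m → ℝ) × (Fin m → ℝ)) : ℝ :=
  ∑ i, (u.1 i * v.2 i - u.2 i * v.1 i)

/-- The standard symplectic form `ω_can` on `ℝ^{2n} = ℝ^{2m} × ℝ × ℝ`. -/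
def wcan (m : ℕ) (u v : EE m) : ℝ :=
  wB m u.1 v.1 + (u.2.1 * v.2.2 - u.2.2 * v.2.1)

/-- `M = ℝ^{2n-2} × (-1,1) × ℝ`. -/
def Mset (m : ℕ) : Set (EE m) := {z | z.2.1 ∈ Ioo (-1 : ℝ) 1}

section SuperpositionOperator

open Filter Topology ContDiff

variable {K : Type*} [TopologicalSpace K] [CompactSpace K]

/-- The superposition operator `γ ↦ f ∘ γ` on continuous maps. -/
def superpose {E F : Type*} [TopologicalSpace E] [TopologicalSpace F] (f : E → F)
    (hf : Continuous f) (γ : C(K, E)) : C(K, F) :=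
  (⟨f, hf⟩ : C(E, F)).comp γ

variable {E F : Type*} [NormedAddCommGroup E] [NormedSpace ℝ E]
  [NormedAddCommGroup F] [NormedSpace ℝ F]

variable (K E F) in
/-- Pointwise application of a continuous family of operators, as a bilinear map. -/
def pointwiseApply : C(K, E →L[ℝ] F) →L[ℝ] C(K, E) →L[ℝ] C(K, F) :=
  LinearMap.mkContinuous₂
    (LinearMap.mk₂ ℝ (fun (A : C(K, E →L[ℝ] F)) (h : C(K, E)) =>
      (⟨fun t => A t (h t), by fun_prop⟩ : C(K, F)))
      (fun _ _ _ => by ext; simp) (fun _ _ _ => by ext; simp)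
      (fun _ _ _ => by ext; simp) (fun _ _ _ => by ext; simp)) 1
    (fun A h => by
      rw [one_mul, ContinuousMap.norm_le _ (by positivity)]
      intro t
      exact (A t).le_of_opNorm_le_of_le (A.norm_coe_le_norm t) (h.norm_coe_le_norm t))

@[simp]
lemma pointwiseApply_apply (A : C(K, E →L[ℝ] F)) (h : C(K, E)) (t : K) :
    pointwiseApply K E F A h t = A t (h t) := rfl

lemma hasFDerivAt_superpose {f : E → F} {f' : E → E →L[ℝ] F} (hf : Continuous f)
    (hf' : Continuous f') (hd : ∀ x, HasFDerivAt f (f' x) x) (γ : C(K, E)) :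
    HasFDerivAt (superpose (K := K) f hf) (pointwiseApply K E F (superpose f' hf' γ)) γ := by
  rw [hasFDerivAt_iff_isLittleO_nhds_zero, Asymptotics.isLittleO_iff]
  intro ε hε
  have huc := (isCompact_range γ.continuous).uniformContinuousAt_of_continuousAt f'
    (fun x _ => hf'.continuousAt) (Metric.dist_mem_uniformity hε)
  obtain ⟨δ, hδ, hδ'⟩ := Metric.mem_uniformity_dist.1 huc
  filter_upwards [Metric.ball_mem_nhds (0 : C(K, E)) hδ] with h hh
  rw [mem_ball_zero_iff] at hh
  rw [ContinuousMap.norm_le _ (by positivity)]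
  intro t
  have hball : Convex ℝ (Metric.ball (γ t) δ) := convex_ball _ _
  have hht : ‖h t‖ ≤ ‖h‖ := h.norm_coe_le_norm t
  have key := hball.norm_image_sub_le_of_norm_hasFDerivWithin_le' (f := f) (f' := f')
    (φ := f' (γ t)) (C := ε) (x := γ t) (y := γ t + h t)
    (fun x _ => (hd x).hasFDerivWithinAt)
    (fun x hx => by
      have := hδ' (a := γ t) (b := x) (by rwa [dist_comm]) (mem_range_self t)
      have h2 : dist (f' (γ t)) (f' x) < ε := this
      rw [dist_comm, dist_eq_norm] at h2
      exact h2.le)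
    (Metric.mem_ball_self hδ) (by simpa using hht.trans_lt hh)
  rw [add_sub_cancel_left] at key
  exact key.trans (by gcongr)

end SuperpositionOperator

section SuperposeSmooth

open Filter Topology ContDiff

universe u

variable {K : Type*} [TopologicalSpace K] [CompactSpace K]

lemma contDiff_superpose_nat (k : ℕ) : ∀ {E F : Type u} [NormedAddCommGroup E] [NormedSpace ℝ E]
    [NormedAddCommGroup F] [NormedSpace ℝ F] {f : E → F} (hf : Continuous f),
    ContDiff ℝ k f → ContDiff ℝ k (superpose (K := K) f hf) := by
  induction k with
  | zero =>
    intro E F _ _ _ _ f hf _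
    exact contDiff_zero.2 (ContinuousMap.continuous_postcomp _)
  | succ k ih =>
    intro E F _ _ _ _ f hf h
    push_cast at h ⊢
    obtain ⟨f', hf', hd⟩ := contDiff_succ_iff_hasFDerivAt.1 h
    have hT : ContDiff ℝ k (pointwiseApply K E F) := by fun_prop
    exact contDiff_succ_iff_hasFDerivAt.2
      ⟨fun γ => pointwiseApply K E F (superpose f' hf'.continuous γ),
        hT.comp (ih hf'.continuous hf'),
        hasFDerivAt_superpose hf hf'.continuous hd⟩

lemma contDiff_superpose {E F : Type u} [NormedAddCommGroup E] [NormedSpace ℝ E]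
    [NormedAddCommGroup F] [NormedSpace ℝ F] {f : E → F} (hf : ContDiff ℝ ∞ f) :
    ContDiff ℝ ∞ (superpose (K := K) f hf.continuous) :=
  contDiff_infty.2 fun k => contDiff_superpose_nat k _ (contDiff_infty.1 hf k)

end SuperposeSmooth

section Volterra

open Filter Topology ContDiff MeasureTheory

variable {E : Type*} [NormedAddCommGroup E]

/-- The constant extension to `ℝ` of a path parametrized by the unit interval. -/
def extendPath (g : C(Icc (0 : ℝ) 1, E)) : ℝ → E := IccExtend zero_le_one g

lemma continuous_extendPath (g : C(Icc (0 : ℝ) 1, E)) : Continuous (extendPath g) :=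
  g.continuous.Icc_extend'

lemma extendPath_of_mem (g : C(Icc (0 : ℝ) 1, E)) {t : ℝ} (ht : t ∈ Icc (0 : ℝ) 1) :
    extendPath g t = g ⟨t, ht⟩ := IccExtend_of_mem _ _ ht

lemma norm_extendPath_le (g : C(Icc (0 : ℝ) 1, E)) (t : ℝ) : ‖extendPath g t‖ ≤ ‖g‖ :=
  g.norm_coe_le_norm _

variable [NormedSpace ℝ E] [CompleteSpace E]

lemma hasDerivAt_integral_extendPath (g : C(Icc (0 : ℝ) 1, E)) (t : ℝ) :
    HasDerivAt (fun t => ∫ s in (0 : ℝ)..t, extendPath g s) (extendPath g t) t :=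
  (continuous_extendPath g).integral_hasStrictDerivAt 0 t |>.hasDerivAt

variable (E) in
/-- The integration operator `g ↦ (t ↦ ∫₀ᵗ g)` on continuous paths. -/
def integrationOperator : C(Icc (0 : ℝ) 1, E) →L[ℝ] C(Icc (0 : ℝ) 1, E) :=
  LinearMap.mkContinuous
    { toFun := fun g => ⟨fun t => ∫ s in (0 : ℝ)..t, extendPath g s,
        (continuous_iff_continuousAt.2 fun t =>
          (hasDerivAt_integral_extendPath g t).continuousAt).comp continuous_subtype_val⟩
      map_add' := fun g h => by
        ext t
        exact intervalIntegral.integral_add ((continuous_extendPath g).intervalIntegrable _ _)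
          ((continuous_extendPath h).intervalIntegrable _ _)
      map_smul' := fun c g => by
        ext t
        exact intervalIntegral.integral_smul c (extendPath g) } 1
    (fun g => by
      rw [one_mul, ContinuousMap.norm_le _ (norm_nonneg _)]
      intro t
      refine (intervalIntegral.norm_integral_le_of_norm_le_const
        (fun s _ => norm_extendPath_le g s)).trans ?_
      rw [sub_zero, abs_of_nonneg t.2.1]
      exact mul_le_of_le_one_right (norm_nonneg _) t.2.2)

lemma integrationOperator_apply (g : C(Icc (0 : ℝ) 1, E)) (t : Icc (0 : ℝ) 1) :
    integrationOperator E g t = ∫ s in (0 : ℝ)..t, extendPath g s := rfl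

/-- The Volterra operator `h ↦ (t ↦ ∫₀ᵗ A s (h s) ds)`. -/
def volterra (A : C(Icc (0 : ℝ) 1, E →L[ℝ] E)) :
    C(Icc (0 : ℝ) 1, E) →L[ℝ] C(Icc (0 : ℝ) 1, E) :=
  integrationOperator E ∘L pointwiseApply _ E E A

lemma norm_volterra_pow_apply_le (A : C(Icc (0 : ℝ) 1, E →L[ℝ] E)) (n : ℕ)
    (h : C(Icc (0 : ℝ) 1, E)) (t : Icc (0 : ℝ) 1) :
    ‖(volterra A ^ n) h t‖ ≤ ‖A‖ ^ n / n.factorial * ‖h‖ * (t : ℝ) ^ n := by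
  induction n generalizing t with
  | zero => simpa using h.norm_coe_le_norm t
  | succ n ih =>
    rw [pow_succ', mul_apply_eq_comp]
    change ‖∫ s in (0 : ℝ)..t, extendPath (pointwiseApply _ E E A ((volterra A ^ n) h)) s‖ ≤ _
    have hbound : ∀ s ∈ Ioc (0 : ℝ) t,
        ‖extendPath (pointwiseApply _ E E A ((volterra A ^ n) h)) s‖ ≤
          ‖A‖ * (‖A‖ ^ n / n.factorial * ‖h‖ * s ^ n) := by
      intro s hs
      have hs' : s ∈ Icc (0 : ℝ) 1 := ⟨hs.1.le, hs.2.trans t.2.2⟩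
      rw [extendPath_of_mem _ hs', pointwiseApply_apply]
      exact (A ⟨s, hs'⟩).le_of_opNorm_le_of_le (A.norm_coe_le_norm _) (ih ⟨s, hs'⟩)
    refine (intervalIntegral.norm_integral_le_of_norm_le t.2.1
      (ae_of_all _ hbound) (by apply Continuous.intervalIntegrable; fun_prop)).trans ?_
    simp_rw [← mul_assoc]
    rw [intervalIntegral.integral_const_mul, integral_pow, Nat.factorial_succ]
    push_cast
    apply le_of_eq
    field_simp
    ring

lemma isUnit_one_sub_of_norm_pow_lt_one {X : Type*} [NormedAddCommGroup X] [NormedSpace ℝ X]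
    [CompleteSpace X] {T : X →L[ℝ] X} {n : ℕ} (h : ‖T ^ n‖ < 1) : IsUnit (1 - T) := by
  have hu := isUnit_one_sub_of_norm_lt_one h
  rw [← mul_neg_geom_sum] at hu
  have hc : Commute (1 - T) (∑ i ∈ Finset.range n, T ^ i) := by
    rw [commute_iff_eq, mul_neg_geom_sum, geom_sum_mul_neg]
  exact (hc.isUnit_mul_iff.1 hu).1

lemma isUnit_one_sub_volterra (A : C(Icc (0 : ℝ) 1, E →L[ℝ] E)) :
    IsUnit (1 - volterra A) := by
  obtain ⟨n, hn⟩ := ((FloorSemiring.tendsto_pow_div_factorial_atTop ‖A‖).eventually_lt_const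
    (zero_lt_one)).exists
  have hnorm : ‖volterra A ^ n‖ < 1 := by
    refine lt_of_le_of_lt (ContinuousLinearMap.opNorm_le_bound _ (by positivity) fun h => ?_) hn
    rw [ContinuousMap.norm_le _ (by positivity)]
    intro t
    refine (norm_volterra_pow_apply_le A n h t).trans ?_
    exact mul_le_of_le_one_right (by positivity) (pow_le_one₀ t.2.1 t.2.2)
  exact isUnit_one_sub_of_norm_pow_lt_one hnorm

end Volterra

section SmoothDependence

open Filter Topology ContDiff

universe u

variable {E : Type u} [NormedAddCommGroup E] [NormedSpace ℝ E]

/-- `X` has an integral curve `γ` on `[0, 1]` inside `M` from `z` to `w`. -/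
structure IsFlowLine (X : E → E) (M : Set E) (γ : ℝ → E) (z w : E) : Prop where
  start : γ 0 = z
  mem_hasDerivAt : ∀ t ∈ Icc (0 : ℝ) 1, γ t ∈ M ∧ HasDerivAt γ (X (γ t)) t
  finish : γ 1 = w

namespace IsFlowLine

variable {X : E → E} {M : Set E} {γ : ℝ → E} {z w : E}

lemma continuousOn (h : IsFlowLine X M γ z w) : ContinuousOn γ (Icc 0 1) :=
  fun t ht => (h.mem_hasDerivAt t ht).2.continuousAt.continuousWithinAt

lemma finish_mem (h : IsFlowLine X M γ z w) : w ∈ M :=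
  h.finish ▸ (h.mem_hasDerivAt 1 (by simp)).1

lemma reverse (h : IsFlowLine X M γ z w) :
    IsFlowLine (fun x => -X x) M (fun t => γ (1 - t)) w z where
  start := by simpa using h.finish
  finish := by simpa using h.start
  mem_hasDerivAt t ht := by
    obtain ⟨hm, hd⟩ := h.mem_hasDerivAt (1 - t) ⟨by linarith [ht.2], by linarith [ht.1]⟩
    exact ⟨hm, by
      simpa [Function.comp_def] using hd.scomp t ((hasDerivAt_id t).const_sub 1)⟩

end IsFlowLine

variable [FiniteDimensional ℝ E]

/-- A smooth vector field on an open set agrees near a given compact subset with a compactly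
supported smooth vector field on the whole space. -/
lemma exists_contDiff_hasCompactSupport_eqOn {X : E → E} {M K : Set E} (hM : IsOpen M)
    (hX : ContDiffOn ℝ ∞ X M) (hK : IsCompact K) (hKM : K ⊆ M) :
    ∃ Y : E → E, ContDiff ℝ ∞ Y ∧ HasCompactSupport Y ∧
      ∃ U, IsOpen U ∧ K ⊆ U ∧ U ⊆ M ∧ EqOn Y X U := by
  obtain ⟨L, hL, hKL, hLM⟩ := exists_compact_between hK hM hKM
  obtain ⟨χ, hχ1, hχ0, -⟩ := exists_contMDiffMap_one_nhds_of_subset_interior (n := ⊤)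
    (modelWithCornersSelf ℝ E) hK.isClosed hKL
  obtain ⟨U, hU, hKU, hU1⟩ := eventually_nhdsSet_iff_exists.1 hχ1
  have hsupp : Function.support (fun x => χ x • X x) ⊆ L := fun x hx => by
    by_contra hxL
    exact hx (by simp [hχ0 x hxL])
  have hts : tsupport (fun x => χ x • X x) ⊆ L := closure_minimal hsupp hL.isClosed
  refine ⟨fun x => χ x • X x, contDiff_iff_contDiffAt.2 fun x => ?_,
    HasCompactSupport.of_support_subset_isCompact hL hsupp,
    U ∩ M, hU.inter hM, subset_inter hKU hKM, inter_subset_right, fun x hx => ?_⟩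
  · by_cases hx : x ∈ M
    · exact χ.contMDiff.contDiff.contDiffAt.smul (hX.contDiffAt (hM.mem_nhds hx))
    · have : (fun x => χ x • X x) =ᶠ[𝓝 x] fun _ => 0 :=
        notMem_tsupport_iff_eventuallyEq.1 fun h => hx (hLM (hts h))
      exact contDiffAt_const.congr_of_eventuallyEq this
  · simp [hU1 x hx.1]

lemma IsFlowLine.unique {X : E → E} {M : Set E} (hM : IsOpen M) (hX : ContDiffOn ℝ ∞ X M)
    {γ γ' : ℝ → E} {z w w' : E} (h : IsFlowLine X M γ z w) (h' : IsFlowLine X M γ' z w') :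
    w = w' := by
  obtain ⟨Y, hY, hYc, U, -, hKU, -, hYX⟩ := exists_contDiff_hasCompactSupport_eqOn hM hX
    (K := image γ (Icc 0 1) ∪ image γ' (Icc 0 1))
    ((isCompact_Icc.image_of_continuousOn h.continuousOn).union
      (isCompact_Icc.image_of_continuousOn h'.continuousOn))
    (union_subset (image_subset_iff.2 fun t ht => (h.mem_hasDerivAt t ht).1)
      (image_subset_iff.2 fun t ht => (h'.mem_hasDerivAt t ht).1))
  obtain ⟨C, hC⟩ := hY.lipschitzWith_of_hasCompactSupport hYc (by simp)
  have := ODE_solution_unique (v := fun _ => Y) (f := γ) (g := γ') (a := 0) (b := 1)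
    (fun _ => hC) h.continuousOn
    (fun t ht => by
      have ht' := Ico_subset_Icc_self ht
      rw [hYX (hKU (.inl (mem_image_of_mem _ ht')))]
      exact (h.mem_hasDerivAt t ht').2.hasDerivWithinAt)
    h'.continuousOn
    (fun t ht => by
      have ht' := Ico_subset_Icc_self ht
      rw [hYX (hKU (.inr (mem_image_of_mem _ ht')))]
      exact (h'.mem_hasDerivAt t ht').2.hasDerivWithinAt)
    (h.start.trans h'.start.symm)
  rw [← h.finish, ← h'.finish, this (by simp)]

/-- Solutions of the integral equation for a smooth vector field depend smoothly on the initial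
value, and the derivative solves the linearized equation. -/
lemma exists_contDiffAt_solution {Y : E → E} (hY : ContDiff ℝ ∞ Y)
    (γ₀ : C(Icc (0 : ℝ) 1, E)) (z₀ : E)
    (h₀ : γ₀ - integrationOperator E (superpose Y hY.continuous γ₀) =
      ContinuousMap.const _ z₀) :
    ∃ Γ : E → C(Icc (0 : ℝ) 1, E), ContDiffAt ℝ ∞ Γ z₀ ∧ Γ z₀ = γ₀ ∧
      (∀ᶠ z in 𝓝 z₀, Γ z - integrationOperator E (superpose Y hY.continuous (Γ z)) =
        ContinuousMap.const _ z) ∧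
      ∀ u, fderiv ℝ Γ z₀ u - volterra (superpose (fderiv ℝ Y)
        (hY.continuous_fderiv (by simp)) γ₀) (fderiv ℝ Γ z₀ u) = ContinuousMap.const _ u := by
  set A := superpose (fderiv ℝ Y) (hY.continuous_fderiv (by simp)) γ₀ with hA
  let G : C(Icc (0 : ℝ) 1, E) → C(Icc (0 : ℝ) 1, E) := fun γ =>
    γ - integrationOperator E (superpose Y hY.continuous γ)
  have hV : ContDiff ℝ ∞ (integrationOperator E) := by fun_prop
  have hG : ContDiff ℝ ∞ G := contDiff_id.sub (hV.comp (contDiff_superpose hY))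
  obtain ⟨e, he⟩ := isUnit_one_sub_volterra A
  let e' := ContinuousLinearEquiv.ofUnit e
  have he' : (e' : C(Icc (0 : ℝ) 1, E) →L[ℝ] C(Icc (0 : ℝ) 1, E)) = 1 - volterra A := by
    rw [← he]; rfl
  have hG' : HasFDerivAt G (e' : C(Icc (0 : ℝ) 1, E) →L[ℝ] C(Icc (0 : ℝ) 1, E)) γ₀ := by
    rw [he']
    exact (hasFDerivAt_id γ₀).sub ((integrationOperator E).hasFDerivAt.comp γ₀
      (hasFDerivAt_superpose hY.continuous (hY.continuous_fderiv (by simp))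
        (fun x => (hY.differentiable (by simp) x).hasFDerivAt) γ₀))
  let c : E →L[ℝ] C(Icc (0 : ℝ) 1, E) := ContinuousLinearMap.const ℝ _
  have hc : ContDiff ℝ ∞ c := by fun_prop
  have hGz : G γ₀ = c z₀ := h₀
  let I := hG.contDiffAt.localInverse hG' (by simp)
  have hI : ContDiffAt ℝ ∞ I (c z₀) := hGz ▸ hG.contDiffAt.to_localInverse hG' (by simp)
  have hI0 : I (c z₀) = γ₀ := hGz ▸ hG.contDiffAt.localInverse_apply_image hG' (by simp)
  have hGI : ∀ᶠ y in 𝓝 (c z₀), G (I y) = y :=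
    hGz ▸ (hG.contDiffAt.hasStrictFDerivAt' hG' (by simp)).eventually_right_inverse
  have hΓ : ContDiffAt ℝ ∞ (fun z => I (c z)) z₀ := hI.comp z₀ hc.contDiffAt
  have hev : ∀ᶠ z in 𝓝 z₀, G (I (c z)) = c z := hc.continuous.continuousAt.eventually hGI
  refine ⟨fun z => I (c z), hΓ, hI0, hev, fun u => ?_⟩
  have h1 : HasFDerivAt (fun z => G (I (c z)))
      ((e' : C(Icc (0 : ℝ) 1, E) →L[ℝ] C(Icc (0 : ℝ) 1, E)) ∘L fderiv ℝ (fun z => I (c z)) z₀) z₀ :=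
    HasFDerivAt.comp z₀ (g := G) (by rw [hI0]; exact hG')
      (hΓ.differentiableAt (by simp)).hasFDerivAt
  have h2 : HasFDerivAt (fun z => G (I (c z))) c z₀ :=
    c.hasFDerivAt.congr_of_eventuallyEq hev
  have h3 := DFunLike.congr_fun (h1.unique h2) u
  rw [he'] at h3
  exact h3

/-- The time-one flow of a smooth vector field is smooth near any point where it is defined, and
its derivative is computed by the linearized equation. -/
lemma IsFlowLine.exists_contDiffAt {X : E → E} {M : Set E} (hM : IsOpen M)
    (hX : ContDiffOn ℝ ∞ X M) {γ : ℝ → E} {z w : E} (h : IsFlowLine X M γ z w) :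
    ∃ φ : E → E, ContDiffAt ℝ ∞ φ z ∧ (∀ᶠ z' in 𝓝 z, ∃ γ', IsFlowLine X M γ' z' (φ z')) ∧
      ∀ u, ∃ η : ℝ → E, η 0 = u ∧ η 1 = fderiv ℝ φ z u ∧
        ∀ t ∈ Icc (0 : ℝ) 1, HasDerivAt η (fderiv ℝ X (γ t) (η t)) t := by
  obtain ⟨Y, hY, -, U, hU, hKU, hUM, hYX⟩ := exists_contDiff_hasCompactSupport_eqOn hM hX
    (isCompact_Icc.image_of_continuousOn h.continuousOn)
    (image_subset_iff.2 fun t ht => (h.mem_hasDerivAt t ht).1)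
  have hγU : ∀ t ∈ Icc (0 : ℝ) 1, γ t ∈ U := fun t ht => hKU (mem_image_of_mem _ ht)
  let γ₀ : C(Icc (0 : ℝ) 1, E) := ⟨fun t => γ t, h.continuousOn.domRestrict⟩
  have h₀ : γ₀ - integrationOperator E (superpose Y hY.continuous γ₀) =
      ContinuousMap.const _ z := by
    ext t
    have hd : ∀ s ∈ uIcc (0 : ℝ) t,
        HasDerivAt γ (extendPath (superpose Y hY.continuous γ₀) s) s := fun s hs => by
      rw [uIcc_of_le t.2.1] at hs
      have hs' : s ∈ Icc (0 : ℝ) 1 := ⟨hs.1, hs.2.trans t.2.2⟩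
      rw [extendPath_of_mem _ hs']
      change HasDerivAt γ (Y (γ s)) s
      rw [hYX (hγU s hs')]
      exact (h.mem_hasDerivAt s hs').2
    have := intervalIntegral.integral_eq_sub_of_hasDerivAt hd
      ((continuous_extendPath _).intervalIntegrable _ _)
    rw [h.start] at this
    simp only [ContinuousMap.sub_apply, integrationOperator_apply, this,
      ContinuousMap.const_apply]
    exact sub_sub_cancel _ _
  obtain ⟨Γ, hΓ, hΓz, hΓe, hΓl⟩ := exists_contDiffAt_solution hY γ₀ z h₀
  let ev : C(Icc (0 : ℝ) 1, E) →L[ℝ] E := ContinuousMap.evalCLM ℝ ⟨1, by simp⟩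
  have hev : ContDiff ℝ ∞ ev := by fun_prop
  refine ⟨fun z => ev (Γ z), hev.contDiffAt.comp z hΓ, ?_, fun u => ?_⟩
  · have hopen : IsOpen {g : C(Icc (0 : ℝ) 1, E) | MapsTo g univ U} :=
      ContinuousMap.isOpen_setOfPred_mapsTo isCompact_univ hU
    have hmem : ∀ᶠ z' in 𝓝 z, MapsTo (Γ z') univ U :=
      hΓ.continuousAt.eventually (hopen.mem_nhds (by
        rw [hΓz]; exact fun t _ => hγU t t.2))
    filter_upwards [hΓe, hmem] with z' hz' hm
    let γ' : ℝ → E := fun t =>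
      z' + ∫ s in (0 : ℝ)..t, extendPath (superpose Y hY.continuous (Γ z')) s
    have hγ' : ∀ t (ht : t ∈ Icc (0 : ℝ) 1), γ' t = Γ z' ⟨t, ht⟩ := fun t ht => by
      have := DFunLike.congr_fun hz' ⟨t, ht⟩
      simp only [ContinuousMap.sub_apply, integrationOperator_apply,
        ContinuousMap.const_apply] at this
      exact (sub_eq_iff_eq_add.1 this).symm
    refine ⟨γ', by simp [γ'], fun t ht => ?_, hγ' 1 (by simp)⟩
    have hU' : γ' t ∈ U := by rw [hγ' t ht]; exact hm (mem_univ _)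
    refine ⟨hUM hU', ?_⟩
    rw [← hYX hU']
    convert (hasDerivAt_integral_extendPath (superpose Y hY.continuous (Γ z')) t).const_add z'
      using 1
    rw [extendPath_of_mem _ ht, hγ' t ht]
    rfl
  · set A := superpose (fderiv ℝ Y) (hY.continuous_fderiv (by simp)) γ₀
    set g := fderiv ℝ Γ z u
    let η : ℝ → E := fun t => u + ∫ s in (0 : ℝ)..t, extendPath (pointwiseApply _ E E A g) s
    have hη : ∀ t (ht : t ∈ Icc (0 : ℝ) 1), η t = g ⟨t, ht⟩ := fun t ht => by
      have := DFunLike.congr_fun (hΓl u) ⟨t, ht⟩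
      change g ⟨t, ht⟩ - ∫ s in (0 : ℝ)..t, extendPath (pointwiseApply _ E E A g) s = u at this
      exact (sub_eq_iff_eq_add.1 this).symm
    refine ⟨η, by simp [η], ?_, fun t ht => ?_⟩
    · rw [hη 1 (by simp)]
      have : HasFDerivAt (fun z => ev (Γ z)) (ev ∘L fderiv ℝ Γ z) z :=
        ev.hasFDerivAt.comp z (hΓ.differentiableAt (by simp)).hasFDerivAt
      rw [this.fderiv]
      rfl
    · have hYX' : Y =ᶠ[𝓝 (γ t)] X := hYX.eventuallyEq_of_mem (hU.mem_nhds (hγU t ht))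
      convert (hasDerivAt_integral_extendPath (pointwiseApply _ E E A g) t).const_add u using 1
      rw [extendPath_of_mem _ ht, hη t ht, ← hYX'.fderiv_eq]
      rfl

end SmoothDependence

section HamiltonianFlow

open Filter Topology ContDiff

/-- The compactly supported smooth vector fields are complete. -/
lemma exists_integralCurve_of_hasCompactSupport {E : Type*} [NormedAddCommGroup E]
    [NormedSpace ℝ E] [CompleteSpace E] {Y : E → E} (hY : ContDiff ℝ ∞ Y)
    (hYc : HasCompactSupport Y) (z : E) :
    ∃ γ : ℝ → E, γ 0 = z ∧ ∀ t ∈ Icc (0 : ℝ) 1, HasDerivAt γ (Y (γ t)) t := by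
  obtain ⟨C, hC⟩ := hY.lipschitzWith_of_hasCompactSupport hYc (by simp)
  obtain ⟨L, hL⟩ := hYc.exists_bound_of_continuous hY.continuous
  have hL0 : 0 ≤ L := (norm_nonneg _).trans (hL z)
  have hpl : IsPicardLindelof (fun _ => Y) (⟨0, by norm_num⟩ : Icc (-1 : ℝ) 2) z
      (2 * ⟨L, hL0⟩) 0 ⟨L, hL0⟩ C :=
    .of_time_independent (fun x _ => hL x) hC.lipschitzOnWith (by
      norm_num
      exact (mul_comm _ _).le)
  obtain ⟨γ, hγ0, hγ⟩ := hpl.exists_eq_forall_mem_Icc_hasDerivWithinAt₀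
  exact ⟨γ, hγ0, fun t ht => (hγ t ⟨by linarith [ht.1], by linarith [ht.2]⟩).hasDerivAt
    (Icc_mem_nhds (by linarith [ht.1]) (by linarith [ht.2]))⟩

variable {m : ℕ}

variable (m) in
/-- The symplectic form as a continuous bilinear map. -/
def wcanL : EE m →L[ℝ] EE m →L[ℝ] ℝ :=
  (LinearMap.mk₂ ℝ (wcan m)
    (fun u v w => by
      simp only [wcan, wB, Prod.fst_add, Prod.snd_add, Pi.add_apply]
      rw [add_add_add_comm, ← Finset.sum_add_distrib]
      congr 1
      · exact Finset.sum_congr rfl fun i _ => by ring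
      · ring)
    (fun c u v => by
      simp only [wcan, wB, Prod.smul_fst, Prod.smul_snd, Pi.smul_apply, smul_eq_mul]
      rw [mul_add, Finset.mul_sum]
      congr 1
      · exact Finset.sum_congr rfl fun i _ => by ring
      · ring)
    (fun u v w => by
      simp only [wcan, wB, Prod.fst_add, Prod.snd_add, Pi.add_apply]
      rw [add_add_add_comm, ← Finset.sum_add_distrib]
      congr 1
      · exact Finset.sum_congr rfl fun i _ => by ring
      · ring)
    (fun c u v => by
      simp only [wcan, wB, Prod.smul_fst, Prod.smul_snd, Pi.smul_apply, smul_eq_mul]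
      rw [mul_add, Finset.mul_sum]
      congr 1
      · exact Finset.sum_congr rfl fun i _ => by ring
      · ring)).toContinuousBilinearMap

lemma wcanL_apply (u v : EE m) : wcanL m u v = wcan m u v := rfl

lemma wcan_swap (u v : EE m) : wcan m u v = -wcan m v u := by
  simp only [wcan, wB, neg_add, ← Finset.sum_neg_distrib]
  congr 1
  · exact Finset.sum_congr rfl fun i _ => by ring
  · ring

lemma wcan_self (u : EE m) : wcan m u u = 0 := by
  linarith [wcan_swap u u]

variable (m) in
/-- The vector dual to a linear form with respect to `ω_can`. -/
def symplecticSharp : (EE m →L[ℝ] ℝ) →L[ℝ] EE m :=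
  LinearMap.toContinuousLinearMap
    { toFun := fun α => ((fun i => α ((0, Pi.single i 1), 0),
        fun i => -α ((Pi.single i 1, 0), 0)), α (0, (0, 1)), -α (0, (1, 0)))
      map_add' := fun α β => by ext <;> simp <;> ring
      map_smul' := fun c α => by ext <;> simp }

lemma wcan_symplecticSharp (α : EE m →L[ℝ] ℝ) (w : EE m) :
    wcan m (symplecticSharp m α) w = α w := by
  obtain ⟨⟨a, b⟩, x, y⟩ := w
  have hw : (((a, b), x, y) : EE m) =
      ∑ i, (a i • (((Pi.single i 1, 0), 0) : EE m) + b i • (((0, Pi.single i 1), 0) : EE m)) +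
        (x • ((0, (1, 0)) : EE m) + y • ((0, (0, 1)) : EE m)) := by
    ext j
    · simp [Prod.fst_sum, Finset.sum_apply, Pi.single_apply]
    · simp [Prod.fst_sum, Prod.snd_sum, Finset.sum_apply, Pi.single_apply]
    · simp [Prod.snd_sum]
    · simp [Prod.snd_sum]
  rw [hw]
  simp only [map_add, map_sum, map_smul, smul_eq_mul]
  rw [← hw]
  simp only [wcan, wB, symplecticSharp, LinearMap.coe_toContinuousLinearMap', LinearMap.coe_mk,
    AddHom.coe_mk]
  congr 1
  · exact Finset.sum_congr rfl fun i _ => by ring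
  · ring

/-- The Hamiltonian vector field of `F`. -/
def hamVF (F : EE m → ℝ) (z : EE m) : EE m := symplecticSharp m (fderiv ℝ F z)

lemma wcan_hamVF (F : EE m → ℝ) (z w : EE m) : wcan m (hamVF F z) w = fderiv ℝ F z w :=
  wcan_symplecticSharp _ _

lemma hamVF_neg (F : EE m → ℝ) : hamVF (fun z => -F z) = fun z => -hamVF F z := by
  ext1 z
  simp only [hamVF, fderiv_fun_neg, map_neg]

lemma contDiffOn_hamVF {F : EE m → ℝ} {M : Set (EE m)} (hM : IsOpen M)
    (hF : ContDiffOn ℝ ∞ F M) : ContDiffOn ℝ ∞ (hamVF F) M :=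
  (symplecticSharp m).contDiff.comp_contDiffOn (hF.fderiv_of_isOpen hM (by simp))

lemma hamiltonian_const_of_hasDerivAt {F : EE m → ℝ} {γ : ℝ → EE m} {T : ℝ}
    (h : ∀ t ∈ Icc 0 T, DifferentiableAt ℝ F (γ t) ∧ HasDerivAt γ (hamVF F (γ t)) t) :
    ∀ t ∈ Icc 0 T, F (γ t) = F (γ 0) := by
  have hd : ∀ t ∈ Icc 0 T, HasDerivAt (fun t => F (γ t)) 0 t := fun t ht => by
    have := (h t ht).1.hasFDerivAt.comp_hasDerivAt t (h t ht).2
    rwa [← wcan_hamVF, wcan_self] at this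
  exact constant_of_has_deriv_right_zero
    (fun t ht => (hd t ht).continuousAt.continuousWithinAt)
    (fun t ht => (hd t (Ico_subset_Icc_self ht)).hasDerivWithinAt)

lemma wcan_linearized_const {F : EE m → ℝ} {M : Set (EE m)} (hM : IsOpen M)
    (hF : ContDiffOn ℝ ∞ F M) {γ η ξ : ℝ → EE m} (hγ : ∀ t ∈ Icc (0 : ℝ) 1, γ t ∈ M)
    (hη : ∀ t ∈ Icc (0 : ℝ) 1, HasDerivAt η (fderiv ℝ (hamVF F) (γ t) (η t)) t)
    (hξ : ∀ t ∈ Icc (0 : ℝ) 1, HasDerivAt ξ (fderiv ℝ (hamVF F) (γ t) (ξ t)) t) :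
    wcan m (η 1) (ξ 1) = wcan m (η 0) (ξ 0) := by
  have hw : ∀ p ∈ M, ∀ u v, wcan m (fderiv ℝ (hamVF F) p u) v =
      fderiv ℝ (fderiv ℝ F) p u v := fun p hp u v => by
    have hd : DifferentiableAt ℝ (fderiv ℝ F) p :=
      ((hF.fderiv_of_isOpen hM (m := ∞) (by simp)).contDiffAt
        (hM.mem_nhds hp)).differentiableAt (by simp)
    have := ((symplecticSharp m).hasFDerivAt.comp p hd.hasFDerivAt).fderiv
    change fderiv ℝ (hamVF F) p = _ at this
    rw [this]
    exact wcan_symplecticSharp _ _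
  have hd : ∀ t ∈ Icc (0 : ℝ) 1, HasDerivAt (fun t => wcanL m (η t) (ξ t)) 0 t := fun t ht => by
    have := (wcanL m).hasDerivAt_of_bilinear (fun _ => hη t ht) (fun _ => hξ t ht)
    have hs : IsSymmSndFDerivAt ℝ F (γ t) :=
      (hF.contDiffAt (hM.mem_nhds (hγ t ht))).isSymmSndFDerivAt (by
        simpa using (WithTop.coe_le_coe.2 le_top : ((2 : ℕ∞) : WithTop ℕ∞) ≤ ∞))
    have hsum : wcanL m (η t) (fderiv ℝ (hamVF F) (γ t) (ξ t)) +
        wcanL m (fderiv ℝ (hamVF F) (γ t) (η t)) (ξ t) = 0 := by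
      rw [wcanL_apply, wcanL_apply, wcan_swap (η t), hw _ (hγ t ht), hw _ (hγ t ht), hs.eq]
      ring
    rwa [hsum] at this
  exact constant_of_has_deriv_right_zero
    (fun t ht => (hd t ht).continuousAt.continuousWithinAt)
    (fun t ht => (hd t (Ico_subset_Icc_self ht)).hasDerivWithinAt) 1 (by simp)

/-- If `F` tends to zero at infinity in `M`, its Hamiltonian flow is complete where `F ≠ 0`. -/
lemma exists_isFlowLine_of_ne_zero {F : EE m → ℝ} {M : Set (EE m)} (hM : IsOpen M)
    (hF : ContDiffOn ℝ ∞ F M) (hK : ∀ c > 0, IsCompact {z | z ∈ M ∧ c ≤ |F z|})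
    {z : EE m} (hz : z ∈ M) (hz0 : F z ≠ 0) : ∃ γ w, IsFlowLine (hamVF F) M γ z w := by
  set c := |F z| with hc
  have hc0 : 0 < c := abs_pos.2 hz0
  let σ : ℝ → ℝ := fun s => Real.smoothTransition (4 * s ^ 2 / c ^ 2 - 1)
  have hσ : ContDiff ℝ ∞ σ := Real.smoothTransition.contDiff.comp (by fun_prop)
  have hσ0 : ∀ s, |s| < c / 2 → σ s = 0 := fun s hs => by
    apply Real.smoothTransition.zero_of_nonpos
    rw [sub_nonpos, div_le_one (by positivity), ← sq_abs s]
    nlinarith [abs_nonneg s]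
  have hσ1 : ∀ s, c ^ 2 < 2 * s ^ 2 → σ s = 1 := fun s hs => by
    apply Real.smoothTransition.one_of_one_le
    rw [le_sub_iff_add_le, le_div_iff₀ (by positivity)]
    linarith
  let H : EE m → ℝ := M.indicator fun x => F x * σ (F x)
  have hHM : ∀ x ∈ M, H x = F x * σ (F x) := fun x hx => indicator_of_mem hx _
  have hHK : ∀ x, H x ≠ 0 → x ∈ {z | z ∈ M ∧ c / 2 ≤ |F z|} := fun x hx => by
    have hxM : x ∈ M := mem_of_indicator_ne_zero hx
    refine ⟨hxM, ?_⟩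
    by_contra! hlt
    exact hx (by rw [hHM x hxM, hσ0 _ hlt, mul_zero])
  have hKc := hK (c / 2) (by positivity)
  have hHc : HasCompactSupport H := .of_support_subset_isCompact hKc hHK
  have hH : ContDiff ℝ ∞ H := contDiff_iff_contDiffAt.2 fun x => by
    by_cases hx : x ∈ M
    · have hFx := hF.contDiffAt (hM.mem_nhds hx)
      refine (hFx.mul (hσ.contDiffAt.comp x hFx)).congr_of_eventuallyEq ?_
      filter_upwards [hM.mem_nhds hx] with y hy using hHM y hy
    · refine contDiffAt_const (c := (0 : ℝ)) |>.congr_of_eventuallyEq ?_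
      filter_upwards [hKc.isClosed.isOpen_compl.mem_nhds fun h => hx h.1] with y hy
      by_contra h
      exact hy (hHK y h)
  have hXc : HasCompactSupport (hamVF H) :=
    (hHc.fderiv ℝ).comp_left (g := symplecticSharp m) (map_zero _)
  have hX : ContDiff ℝ ∞ (hamVF H) :=
    contDiffOn_univ.1 (contDiffOn_hamVF isOpen_univ hH.contDiffOn)
  obtain ⟨γ, hγ0, hγ⟩ := exists_integralCurve_of_hasCompactSupport hX hXc z
  have hcons := hamiltonian_const_of_hasDerivAt (F := H)
    fun t ht => ⟨hH.differentiable (by simp) _, hγ t ht⟩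
  have hHz : H z = F z := by
    rw [hHM z hz, hσ1, mul_one]
    nlinarith [sq_abs (F z)]
  refine ⟨γ, γ 1, hγ0, fun t ht => ?_, rfl⟩
  have hval : H (γ t) = F z := by rw [hcons t ht, hγ0, hHz]
  have hmem : γ t ∈ M := mem_of_indicator_ne_zero (hval.trans_ne hz0)
  have hle : c ≤ |F (γ t)| := by
    rw [hc, ← hval, hHM _ hmem, abs_mul, abs_of_nonneg (Real.smoothTransition.nonneg _)]
    exact mul_le_of_le_one_right (abs_nonneg _) (Real.smoothTransition.le_one _)
  refine ⟨hmem, ?_⟩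
  have hgt : c ^ 2 < 2 * F (γ t) ^ 2 := by nlinarith [sq_abs (F (γ t))]
  have hev : H =ᶠ[𝓝 (γ t)] F := by
    have hcont := ((hF.contDiffAt (hM.mem_nhds hmem)).continuousAt.pow 2).const_mul 2
    filter_upwards [hM.mem_nhds hmem, hcont.eventually_const_lt hgt] with y hy hy'
    rw [hHM y hy, hσ1 _ hy', mul_one]
  have := hγ t ht
  rwa [hamVF, hev.fderiv_eq] at this

/-- The time-one map of the Hamiltonian flow is a symplectomorphism from `S` onto `M` as soon as
trajectories from `S` exist up to time one and every point of `M` flows back into `S`. -/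
lemma exists_symplectomorphism_of_isFlowLine {F : EE m → ℝ} {M S : Set (EE m)} (hM : IsOpen M)
    (hF : ContDiffOn ℝ ∞ F M) (hfwd : ∀ z ∈ S, ∃ γ w, IsFlowLine (hamVF F) M γ z w)
    (hbwd : ∀ z ∈ M, ∃ γ, ∃ w ∈ S, IsFlowLine (hamVF fun x => -F x) M γ z w) :
    ∃ φ : EE m → EE m, (∀ z ∈ S, ∃ γ, IsFlowLine (hamVF F) M γ z (φ z)) ∧
      ContDiffOn ℝ ∞ φ S ∧ BijOn φ S M ∧
      (∃ ψ : EE m → EE m, ContDiffOn ℝ ∞ ψ M ∧ InvOn ψ φ S M) ∧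
      ∀ z ∈ S, ∀ u v, wcan m (fderiv ℝ φ z u) (fderiv ℝ φ z v) = wcan m u v := by
  classical
  have key : ∀ G : EE m → ℝ, ContDiffOn ℝ ∞ G M → ∃ φ : EE m → EE m,
      (∀ z γ w, IsFlowLine (hamVF G) M γ z w → w = φ z) ∧
      ∀ z γ w, IsFlowLine (hamVF G) M γ z w → ContDiffAt ℝ ∞ φ z ∧
        ∀ u v, wcan m (fderiv ℝ φ z u) (fderiv ℝ φ z v) = wcan m u v := fun G hG => by
    have hX := contDiffOn_hamVF hM hG
    let φ : EE m → EE m := fun z =>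
      if h : ∃ w γ, IsFlowLine (hamVF G) M γ z w then h.choose else z
    have hφ : ∀ z γ w, IsFlowLine (hamVF G) M γ z w → w = φ z := fun z γ w h => by
      have hex : ∃ w γ, IsFlowLine (hamVF G) M γ z w := ⟨w, γ, h⟩
      obtain ⟨γ', h'⟩ := hex.choose_spec
      simp only [φ, dif_pos hex]
      exact h.unique hM hX h'
    refine ⟨φ, hφ, fun z γ w h => ?_⟩
    obtain ⟨φ', hφ', hev, hlin⟩ := h.exists_contDiffAt hM hX
    have heq : φ =ᶠ[𝓝 z] φ' := by
      filter_upwards [hev] with z' ⟨γ', h'⟩ using (hφ z' γ' _ h').symm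
    refine ⟨hφ'.congr_of_eventuallyEq heq, fun u v => ?_⟩
    obtain ⟨η, hη0, hη1, hη⟩ := hlin u
    obtain ⟨ξ, hξ0, hξ1, hξ⟩ := hlin v
    rw [heq.fderiv_eq, ← hη1, ← hξ1, ← hη0, ← hξ0]
    exact wcan_linearized_const hM hG (fun t ht => (h.mem_hasDerivAt t ht).1) hη hξ
  obtain ⟨φ, hφ, hφd⟩ := key F hF
  obtain ⟨ψ, hψ, hψd⟩ := key (fun x => -F x) hF.neg
  have hφS : ∀ z ∈ S, ∃ γ, IsFlowLine (hamVF F) M γ z (φ z) := fun z hz => by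
    obtain ⟨γ, w, h⟩ := hfwd z hz
    exact ⟨γ, hφ z γ w h ▸ h⟩
  have hψM : ∀ z ∈ M, ψ z ∈ S ∧ ∃ γ, IsFlowLine (hamVF fun x => -F x) M γ z (ψ z) := by
    intro z hz
    obtain ⟨γ, w, hw, h⟩ := hbwd z hz
    rw [← hψ z γ w h]
    exact ⟨hw, γ, h⟩
  have hinv : InvOn ψ φ S M := by
    refine ⟨fun z hz => ?_, fun z hz => ?_⟩
    · obtain ⟨γ, h⟩ := hφS z hz
      exact (hψ _ _ _ (by simpa only [hamVF_neg] using h.reverse)).symm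
    · obtain ⟨-, γ, h⟩ := hψM z hz
      exact (hφ _ _ _ (by simpa only [hamVF_neg, neg_neg] using h.reverse)).symm
  have hmaps : MapsTo φ S M := fun z hz => (hφS z hz).choose_spec.finish_mem
  refine ⟨φ, hφS, fun z hz => ?_, hinv.bijOn hmaps fun z hz => (hψM z hz).1, ⟨ψ, fun z hz => ?_,
    hinv⟩, fun z hz => ?_⟩
  · obtain ⟨γ, h⟩ := hφS z hz
    exact (hφd _ _ _ h).1.contDiffWithinAt
  · obtain ⟨-, γ, h⟩ := hψM z hz
    exact (hψd _ _ _ h).1.contDiffWithinAt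
  · obtain ⟨γ, h⟩ := hφS z hz
    exact (hφd _ _ _ h).2

end HamiltonianFlow

section Excision

open Filter Topology ContDiff

/-- The speed at which `τ` has to move so that `τ (τ + ρ + δ) / (τ + ρ)` decays exponentially. -/
def decaySpeed (ρ δ τ : ℝ) : ℝ := τ * (τ + ρ) * (τ + ρ + δ) / ((τ + ρ) ^ 2 + δ * ρ)

lemma decaySpeed_pos {ρ δ τ : ℝ} (hρ : 0 ≤ ρ) (hδ : 0 ≤ δ) (hτ : 0 < τ) :
    0 < decaySpeed ρ δ τ := by
  unfold decaySpeed
  positivity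

lemma exists_hasDerivAt_decaySpeed {ρ δ τ₀ : ℝ} (hρ : 0 ≤ ρ) (hδ : 0 ≤ δ) (hτ₀ : 0 < τ₀) (ε : ℝ)
    (h : 0 < ρ ∨ ∀ t ∈ Icc (0 : ℝ) 1, δ < Real.exp (ε * t) * (τ₀ + δ)) :
    ∃ τ : ℝ → ℝ, τ 0 = τ₀ ∧
      (∀ t ∈ Icc (0 : ℝ) 1, 0 < τ t ∧ HasDerivAt τ (ε * decaySpeed ρ δ (τ t)) t) ∧
      (ρ = 0 → τ 1 + δ = Real.exp ε * (τ₀ + δ)) := by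
  have hexp : ∀ a t : ℝ, HasDerivAt (fun t => Real.exp (ε * t) * a)
      (ε * (Real.exp (ε * t) * a)) t := fun a t => by
    refine (((hasDerivAt_id t).const_mul ε).exp.mul_const a).congr_deriv ?_
    simp only [id, mul_one]
    ring
  rcases hρ.eq_or_lt with rfl | hρ
  · refine ⟨fun t => Real.exp (ε * t) * (τ₀ + δ) - δ, by simp, fun t ht => ?_, by simp⟩
    have hpos : 0 < Real.exp (ε * t) * (τ₀ + δ) - δ :=
      sub_pos.2 ((h.resolve_left (lt_irrefl _)) t ht)
    refine ⟨hpos, ?_⟩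
    refine ((hexp (τ₀ + δ) t).sub_const δ).congr_deriv ?_
    unfold decaySpeed
    field_simp
    ring
  · set w₀ := τ₀ * (τ₀ + ρ + δ) / (τ₀ + ρ) with hw₀
    have hw₀pos : 0 < w₀ := by positivity
    have hw₀eq : w₀ * (τ₀ + ρ) = τ₀ * (τ₀ + ρ + δ) := by rw [hw₀]; field_simp
    let W : ℝ → ℝ := fun t => Real.exp (ε * t) * w₀
    have hW : ∀ t, 0 < W t := fun t => by positivity
    let Δ : ℝ → ℝ := fun t => (ρ + δ - W t) ^ 2 + 4 * ρ * W t
    have hΔ : ∀ t, 0 < Δ t := fun t => by have := hW t; positivity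
    let τ : ℝ → ℝ := fun t => (-(ρ + δ - W t) + √(Δ t)) / 2
    have hτ : ∀ t, 0 < τ t := fun t => by
      have : |ρ + δ - W t| < √(Δ t) := by
        rw [← Real.sqrt_sq_eq_abs]
        exact Real.sqrt_lt_sqrt (sq_nonneg _) (by have := mul_pos hρ (hW t); simp only [Δ]; linarith)
      have := (le_abs_self _).trans_lt this
      simp only [τ]
      linarith
    have hquad : ∀ t, W t * (τ t + ρ) = τ t * (τ t + ρ + δ) := fun t => by
      have := Real.sq_sqrt (hΔ t).le
      simp only [Δ] at this
      simp only [τ, Δ]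
      nlinarith
    have hsqrt : ∀ t, √(Δ t) = 2 * τ t + (ρ + δ - W t) := fun t => by simp only [τ]; ring
    refine ⟨τ, ?_, fun t _ => ⟨hτ t, ?_⟩, fun h => absurd h hρ.ne'⟩
    · have h0 : W 0 = w₀ := by simp [W]
      have hq := hquad 0
      rw [h0] at hq
      have : (τ 0 - τ₀) * ((τ 0 + ρ) * (τ₀ + ρ) + δ * ρ) = 0 := by
        linear_combination (-(τ₀ + ρ)) * hq + (τ 0 + ρ) * hw₀eq
      have hne : (τ 0 + ρ) * (τ₀ + ρ) + δ * ρ ≠ 0 := by have := hτ 0; positivity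
      exact sub_eq_zero.1 ((mul_eq_zero.1 this).resolve_right hne)
    · have hWd : HasDerivAt W (ε * W t) t := hexp w₀ t
      have hΔd : HasDerivAt Δ (2 * (ρ + δ - W t) * -(ε * W t) + 4 * ρ * (ε * W t)) t := by
        refine (((hWd.const_sub (ρ + δ)).pow 2).add (hWd.const_mul (4 * ρ))).congr_deriv ?_
        simp
      have := ((hWd.const_sub (ρ + δ)).neg.add (hΔd.sqrt (hΔ t).ne')).div_const 2
      refine this.congr_deriv ?_
      have hs : 0 < √(Δ t) := Real.sqrt_pos.2 (hΔ t)
      have hτt := hτ t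
      have hWt : W t = τ t * (τ t + ρ + δ) / (τ t + ρ) := by
        rw [eq_div_iff (by positivity), hquad t]
      have hs' : √(Δ t) = ((τ t + ρ) ^ 2 + δ * ρ) / (τ t + ρ) := by
        rw [hsqrt, hWt]; field_simp; ring
      rw [hs', decaySpeed, hWt]
      field_simp
      ring

/-- The involution exchanging `(-1, 1)` and `(0, ∞)`. -/
def cayley (x : ℝ) : ℝ := (1 - x) / (1 + x)

lemma cayley_pos {x : ℝ} (hx : x ∈ Ioo (-1 : ℝ) 1) : 0 < cayley x :=
  div_pos (by linarith [hx.2]) (by linarith [hx.1])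

lemma cayley_mem_Ioo {τ : ℝ} (hτ : 0 < τ) : cayley τ ∈ Ioo (-1 : ℝ) 1 := by
  constructor
  · rw [cayley, lt_div_iff₀ (by linarith)]
    linarith
  · rw [cayley, div_lt_iff₀ (by linarith)]
    linarith

lemma cayley_cayley {x : ℝ} (hx : -1 < x) : cayley (cayley x) = x := by
  have : 1 + x ≠ 0 := by linarith
  unfold cayley
  field_simp
  ring

lemma cayley_lt_cayley {x x' : ℝ} (hx : -1 < x) (h : x < x') : cayley x' < cayley x := by
  rw [cayley, cayley, div_lt_div_iff₀ (by linarith) (by linarith)]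
  nlinarith

lemma cayley_le_cayley {x x' : ℝ} (hx : -1 < x) (h : x ≤ x') : cayley x' ≤ cayley x := by
  rcases h.eq_or_lt with rfl | h
  exacts [le_rfl, (cayley_lt_cayley hx h).le]

lemma hasDerivAt_cayley {τ : ℝ} (hτ : 0 < τ) : HasDerivAt cayley (-2 / (1 + τ) ^ 2) τ := by
  refine (((hasDerivAt_id τ).const_sub 1).div ((hasDerivAt_id τ).const_add 1)
    (by simp only [id]; linarith)).congr_deriv ?_
  simp only [id]
  ring

variable {m : ℕ}

lemma isOpen_Mset : IsOpen (Mset m) :=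
  isOpen_Ioo.preimage (by fun_prop : Continuous fun z : EE m => z.2.1)

/-- The velocity along `{yₙ = 0}` for which `cayley xₙ` obeys the law `decaySpeed`. -/
def axisSpeed (ρ δ : (Fin m → ℝ) × (Fin m → ℝ) → ℝ) (z : EE m) : ℝ :=
  (1 + z.2.1) ^ 2 / 2 * decaySpeed (ρ z.1) (δ z.1) (cayley z.2.1)

lemma axisSpeed_pos {ρ δ : (Fin m → ℝ) × (Fin m → ℝ) → ℝ} (hρ : ∀ p, 0 ≤ ρ p)
    (hδ : ∀ p, 0 ≤ δ p) {z : EE m} (hz : z ∈ Mset m) : 0 < axisSpeed ρ δ z := by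
  have : 0 < 1 + z.2.1 := by linarith [hz.1]
  have := decaySpeed_pos (hρ z.1) (hδ z.1) (cayley_pos hz)
  unfold axisSpeed
  positivity

lemma contDiffOn_axisSpeed {ρ δ : (Fin m → ℝ) × (Fin m → ℝ) → ℝ} (hρ : ∀ p, 0 ≤ ρ p)
    (hδ : ∀ p, 0 ≤ δ p) (hρs : ContDiff ℝ ∞ ρ) (hδs : ContDiff ℝ ∞ δ) :
    ContDiffOn ℝ ∞ (axisSpeed ρ δ) (Mset m) := by
  have hx : ContDiffOn ℝ ∞ (fun z : EE m => z.2.1) (Mset m) := by fun_prop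
  have hr : ContDiffOn ℝ ∞ (fun z : EE m => ρ z.1) (Mset m) :=
    (hρs.comp contDiff_fst).contDiffOn
  have hd : ContDiffOn ℝ ∞ (fun z : EE m => δ z.1) (Mset m) :=
    (hδs.comp contDiff_fst).contDiffOn
  have hc : ContDiffOn ℝ ∞ (fun z : EE m => cayley z.2.1) (Mset m) :=
    (contDiffOn_const.sub hx).div (contDiffOn_const.add hx) fun z hz => by linarith [hz.1]
  refine (((contDiffOn_const.add hx).pow 2).div_const 2).mul
    (((hc.mul (hc.add hr)).mul ((hc.add hr).add hd)).div (((hc.add hr).pow 2).add (hd.mul hr))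
      fun z hz => ?_)
  have := cayley_pos hz
  have := hρ z.1
  have := hδ z.1
  positivity

lemma exists_isFlowLine_axis {ρ δ : (Fin m → ℝ) × (Fin m → ℝ) → ℝ} (hρ : ∀ p, 0 ≤ ρ p)
    (hδ : ∀ p, 0 ≤ δ p) {X : EE m → EE m} {ε : ℝ}
    (hX : ∀ z ∈ Mset m, z.2.2 = 0 → X z = (0, -ε * axisSpeed ρ δ z, 0))
    (p : (Fin m → ℝ) × (Fin m → ℝ)) {x : ℝ} (hx : x ∈ Ioo (-1 : ℝ) 1)
    (h : 0 < ρ p ∨ ∀ t ∈ Icc (0 : ℝ) 1, δ p < Real.exp (ε * t) * (cayley x + δ p)) :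
    ∃ γ x', IsFlowLine X (Mset m) γ (p, x, 0) (p, x', 0) ∧
      (ρ p = 0 → cayley x' + δ p = Real.exp ε * (cayley x + δ p)) := by
  obtain ⟨τ, hτ0, hτ, hτ1⟩ :=
    exists_hasDerivAt_decaySpeed (hρ p) (hδ p) (cayley_pos hx) ε h
  refine ⟨fun t => (p, cayley (τ t), 0), cayley (τ 1), ⟨?_, fun t ht => ?_, rfl⟩, fun h0 => ?_⟩
  · rw [hτ0, cayley_cayley hx.1]
  · obtain ⟨hpos, hd⟩ := hτ t ht
    have hmem : (p, cayley (τ t), 0) ∈ Mset m := cayley_mem_Ioo hpos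
    refine ⟨hmem, ?_⟩
    rw [hX _ hmem rfl]
    refine (hasDerivAt_const t p).prodMk (HasDerivAt.prodMk ?_ (hasDerivAt_const t 0))
    refine ((hasDerivAt_cayley hpos).comp t hd).congr_deriv ?_
    simp only [axisSpeed]
    rw [cayley_cayley (by linarith), cayley]
    have : 1 + τ t ≠ 0 := by linarith
    field_simp
    ring
  · rw [cayley_cayley (by linarith [(hτ 1 (by simp)).1]), hτ1 h0]

/-- A weight which is proper on the horizontal part of `M`. -/
def horizontalWeight (z : EE m) : ℝ :=
  (1 + ∑ i, (z.1.1 i ^ 2 + z.1.2 i ^ 2)) / (1 - z.2.1 ^ 2)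

/-- A Hamiltonian which vanishes at infinity and whose flow has velocity `g` on `{yₙ = 0}`. -/
def properHamiltonian (g : EE m → ℝ) (z : EE m) : ℝ :=
  z.2.2 * (g z / (1 + horizontalWeight z * (1 + g z ^ 2) * z.2.2 ^ 2))

lemma one_sub_sq_pos_of_mem_Mset {z : EE m} (hz : z ∈ Mset m) : 0 < 1 - z.2.1 ^ 2 := by
  nlinarith [mul_pos (neg_lt_iff_pos_add.1 hz.1) (sub_pos.2 hz.2)]

lemma horizontalWeight_pos {z : EE m} (hz : z ∈ Mset m) : 0 < horizontalWeight z :=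
  div_pos (by positivity) (one_sub_sq_pos_of_mem_Mset hz)

lemma properHamiltonian_denom_pos (g : EE m → ℝ) {z : EE m} (hz : z ∈ Mset m) :
    0 < 1 + horizontalWeight z * (1 + g z ^ 2) * z.2.2 ^ 2 := by
  have := horizontalWeight_pos hz
  positivity

lemma contDiffOn_properHamiltonian_factor {g : EE m → ℝ} (hg : ContDiffOn ℝ ∞ g (Mset m)) :
    ContDiffOn ℝ ∞ (fun z => g z / (1 + horizontalWeight z * (1 + g z ^ 2) * z.2.2 ^ 2))
      (Mset m) := by
  have hE : ContDiffOn ℝ ∞ (horizontalWeight (m := m)) (Mset m) := by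
    refine ContDiffOn.div ?_ ?_ fun z hz => (one_sub_sq_pos_of_mem_Mset hz).ne'
    · fun_prop
    · fun_prop
  have hy : ContDiffOn ℝ ∞ (fun z : EE m => z.2.2) (Mset m) := by fun_prop
  exact hg.div (contDiffOn_const.add ((hE.mul (contDiffOn_const.add (hg.pow 2))).mul (hy.pow 2)))
    fun z hz => (properHamiltonian_denom_pos g hz).ne'

lemma contDiffOn_properHamiltonian {g : EE m → ℝ} (hg : ContDiffOn ℝ ∞ g (Mset m)) :
    ContDiffOn ℝ ∞ (properHamiltonian g) (Mset m) :=
  ContDiffOn.mul (by fun_prop) (contDiffOn_properHamiltonian_factor hg)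

lemma properHamiltonian_eq_zero_iff {g : EE m → ℝ} {z : EE m} (hz : z ∈ Mset m)
    (hg : 0 < g z) : properHamiltonian g z = 0 ↔ z.2.2 = 0 := by
  rw [properHamiltonian, mul_eq_zero, or_iff_left]
  exact (div_pos hg (properHamiltonian_denom_pos g hz)).ne'

lemma hamVF_properHamiltonian {g : EE m → ℝ} (hg : ContDiffOn ℝ ∞ g (Mset m)) {z : EE m}
    (hz : z ∈ Mset m) (hy : z.2.2 = 0) : hamVF (properHamiltonian g) z = (0, g z, 0) := by
  have hd := ((contDiffOn_properHamiltonian_factor hg).contDiffAt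
    (isOpen_Mset.mem_nhds hz)).differentiableAt (by simp)
  have h2 : HasFDerivAt (fun z : EE m => z.2.2)
      ((ContinuousLinearMap.snd ℝ ℝ ℝ).comp
        (ContinuousLinearMap.snd ℝ ((Fin m → ℝ) × (Fin m → ℝ)) (ℝ × ℝ))) z :=
    ((ContinuousLinearMap.snd ℝ ℝ ℝ).comp
      (ContinuousLinearMap.snd ℝ ((Fin m → ℝ) × (Fin m → ℝ)) (ℝ × ℝ))).hasFDerivAt
  have hF : fderiv ℝ (properHamiltonian g) z = _ := (h2.mul hd.hasFDerivAt).fderiv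
  rw [hamVF, hF]
  simp [symplecticSharp, hy]
  exact .inr rfl

lemma isCompact_properHamiltonian {g : EE m → ℝ} (hg : ContDiffOn ℝ ∞ g (Mset m)) {c : ℝ}
    (hc : 0 < c) : IsCompact {z | z ∈ Mset m ∧ c ≤ |properHamiltonian g z|} := by
  let K : Set (EE m) := Metric.closedBall 0 (1 / c) ×ˢ
    (Icc (-(1 - 2 * c ^ 2)) (1 - 2 * c ^ 2) ×ˢ Icc (-(1 / c)) (1 / c))
  have hK : IsCompact K := (isCompact_closedBall _ _).prod (isCompact_Icc.prod isCompact_Icc)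
  have hKM : K ⊆ Mset m := fun z hz => by
    have := pow_pos hc 2
    exact ⟨by linarith [hz.2.1.1], by linarith [hz.2.1.2]⟩
  have hbound : ∀ z ∈ Mset m, c ≤ |properHamiltonian g z| → z ∈ K := fun z hz h => by
    have hE := horizontalWeight_pos hz
    set E := horizontalWeight z with hE_def
    set y := z.2.2
    have hx := one_sub_sq_pos_of_mem_Mset hz
    set S := ∑ i, (z.1.1 i ^ 2 + z.1.2 i ^ 2) with hS
    have hS0 : 0 ≤ S := by positivity
    have hES : E * (1 - z.2.1 ^ 2) = 1 + S := by
      rw [hE_def, horizontalWeight, div_mul_cancel₀ _ hx.ne']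
    have hE1 : 1 + S ≤ E := by nlinarith [sq_nonneg z.2.1]
    have hD := properHamiltonian_denom_pos g hz
    set D := 1 + E * (1 + g z ^ 2) * y ^ 2 with hD_def
    have hF : c ^ 2 * D ^ 2 ≤ y ^ 2 * g z ^ 2 := by
      have h1 : c ^ 2 ≤ properHamiltonian g z ^ 2 := by
        rw [← sq_abs (properHamiltonian g z)]
        exact pow_le_pow_left₀ hc.le h 2
      rw [properHamiltonian, mul_pow, div_pow, ← mul_div_assoc,
        le_div_iff₀ (pow_pos hD 2)] at h1
      exact h1
    have hgy : 0 ≤ y ^ 2 * g z ^ 2 := by positivity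
    have hD1 : y ^ 2 * (1 + g z ^ 2) ≤ D := by
      have : 0 ≤ (E - 1) * (y ^ 2 * (1 + g z ^ 2)) := mul_nonneg (by linarith) (by positivity)
      rw [hD_def]
      linarith
    have hcD : c ^ 2 * D ≤ 1 := by
      refine le_of_mul_le_mul_right ?_ hD
      nlinarith [sq_nonneg y]
    have hy : (c * y) ^ 2 ≤ 1 := by
      rw [mul_pow]
      nlinarith [mul_le_mul_of_nonneg_left hD1 (sq_nonneg c),
        mul_nonneg (sq_nonneg c) hgy]
    have hD2 : 4 * E * (y ^ 2 * g z ^ 2) ≤ D ^ 2 := by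
      have h1 : 1 + E * (y ^ 2 * g z ^ 2) ≤ D := by
        rw [hD_def]
        nlinarith [mul_nonneg hE.le (sq_nonneg y)]
      have h2 : 0 ≤ 1 + E * (y ^ 2 * g z ^ 2) := by positivity
      nlinarith [sq_nonneg (1 - E * (y ^ 2 * g z ^ 2)), pow_le_pow_left₀ h2 h1 2]
    have hcE : 4 * c ^ 2 * E ≤ 1 := by
      refine le_of_mul_le_mul_right ?_ (pow_pos hD 2)
      nlinarith [mul_le_mul_of_nonneg_left hF (by positivity : 0 ≤ 4 * E)]
    have hp : ∀ s, s ^ 2 ≤ S → |s| ≤ 1 / c := fun s hs => by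
      rw [le_div_iff₀ hc, ← abs_of_pos hc, ← abs_mul, abs_le_one_iff_mul_self_le_one]
      nlinarith [mul_le_mul_of_nonneg_left hs (sq_nonneg c),
        mul_le_mul_of_nonneg_left hE1 (sq_nonneg c), sq_nonneg c]
    have hterm : ∀ i, z.1.1 i ^ 2 + z.1.2 i ^ 2 ≤ S := fun i =>
      Finset.single_le_sum (f := fun i => z.1.1 i ^ 2 + z.1.2 i ^ 2)
        (fun j _ => by positivity) (Finset.mem_univ i)
    have hx2 : 4 * c ^ 2 ≤ 1 - z.2.1 ^ 2 := by
      nlinarith [mul_le_mul_of_nonneg_right hcE hx.le]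
    refine ⟨?_, ?_, ?_⟩
    · rw [mem_closedBall_zero_iff]
      refine max_le ((pi_norm_le_iff_of_nonneg (by positivity)).2 fun i => hp _ ?_)
        ((pi_norm_le_iff_of_nonneg (by positivity)).2 fun i => hp _ ?_)
      · linarith [hterm i, sq_nonneg (z.1.2 i)]
      · linarith [hterm i, sq_nonneg (z.1.1 i)]
    · have h1 := hz.1
      have h2 := hz.2
      constructor <;> nlinarith
    · rw [mem_Icc, ← abs_le, le_div_iff₀ hc, ← abs_of_pos hc, ← abs_mul,
        abs_le_one_iff_mul_self_le_one]
      linarith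
  have heq : {z | z ∈ Mset m ∧ c ≤ |properHamiltonian g z|} =
      K ∩ (fun z => |properHamiltonian g z|) ⁻¹' Ici c :=
    ext fun z => ⟨fun h => ⟨hbound z h.1 h.2, h.2⟩, fun h => ⟨hKM h.1, h.2⟩⟩
  rw [heq]
  exact hK.of_isClosed_subset
    (((contDiffOn_properHamiltonian hg).continuousOn.mono hKM).abs.preimage_isClosed_of_isClosed
      hK.isClosed isClosed_Ici) inter_subset_left

end Excision
/-- Let `C ⊆ ℝ^{2n-2}` be closed and `l : ℝ^{2n-2} → ℝ` smooth with `-1 < l ≤ 1`, and let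
`Z = {(p, x, 0) ∈ M : p ∈ C, l p ≤ x}` inside `M = ℝ^{2n-2} × (-1,1) × ℝ`.  Then `Z`
is time-independent Hamiltonian excisable from `(M, ω_can)`: there is a smooth `F : M → ℝ`
whose Hamiltonian vector field `X = X_F` (characterized on `M` by `ω_can(X z, w) = dF_z w`)
has: forward trajectories starting in `Z` stay in `Z` as long as they are defined;
trajectories starting in `M ∖ Z` are defined (in `M`) at least on `[0,1]`; and the time-1
flow map `φ` is a symplectomorphism from `M ∖ Z` onto `M`. -/
theorem epigraph_timeIndependent_hamiltonian_excisable (m : ℕ)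
    (C : Set ((Fin m → ℝ) × (Fin m → ℝ))) (hC : IsClosed C)
    (l : (Fin m → ℝ) × (Fin m → ℝ) → ℝ) (hl : ContDiff ℝ (⊤ : ℕ∞) l)
    (hl_range : ∀ p, l p ∈ Ioc (-1 : ℝ) 1)
    (Z : Set (EE m))
    (hZ : Z = {z : EE m | z ∈ Mset m ∧ z.1 ∈ C ∧ l z.1 ≤ z.2.1 ∧ z.2.2 = 0}) :
    ∃ F : EE m → ℝ, ContDiffOn ℝ (⊤ : ℕ∞) F (Mset m) ∧
    ∃ X : EE m → EE m,
      (∀ z ∈ Mset m, ∀ w, wcan m (X z) w = fderiv ℝ F z w) ∧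
      (∀ (γ : ℝ → EE m) (T : ℝ), 0 ≤ T → γ 0 ∈ Z →
        (∀ t ∈ Icc 0 T, γ t ∈ Mset m ∧ HasDerivAt γ (X (γ t)) t) →
        ∀ t ∈ Icc 0 T, γ t ∈ Z) ∧
      ∃ φ : EE m → EE m,
        (∀ z ∈ Mset m \ Z, ∃ γ : ℝ → EE m, γ 0 = z ∧
          (∀ t ∈ Icc (0:ℝ) 1, γ t ∈ Mset m ∧ HasDerivAt γ (X (γ t)) t) ∧ γ 1 = φ z) ∧
        ContDiffOn ℝ (⊤ : ℕ∞) φ (Mset m \ Z) ∧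
        BijOn φ (Mset m \ Z) (Mset m) ∧
        (∃ ψ : EE m → EE m, ContDiffOn ℝ (⊤ : ℕ∞) ψ (Mset m) ∧ InvOn ψ φ (Mset m \ Z) (Mset m)) ∧
        (∀ z ∈ Mset m \ Z, ∀ u v,
          wcan m (fderiv ℝ φ z u) (fderiv ℝ φ z v) = wcan m u v) := by
  obtain ⟨ρ, hρsupp, hρs, hρrange⟩ := hC.isOpen_compl.exists_contDiff_support_eq (n := ⊤)
  have hρ : ∀ p, 0 ≤ ρ p := fun p => (hρrange (mem_range_self p)).1
  have hρC : ∀ p, ρ p = 0 ↔ p ∈ C := fun p => by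
    rw [← Function.notMem_support, hρsupp, mem_compl_iff, not_not]
  set e := Real.exp 1
  have he : 0 < e - 1 := by linarith [Real.add_one_lt_exp (one_ne_zero' ℝ)]
  let δ : (Fin m → ℝ) × (Fin m → ℝ) → ℝ := fun p => cayley (l p) / (e - 1)
  have hδ : ∀ p, 0 ≤ δ p := fun p =>
    div_nonneg (div_nonneg (by linarith [(hl_range p).2]) (by linarith [(hl_range p).1])) he.le
  have hδs : ContDiff ℝ (⊤ : ℕ∞) δ :=
    ((contDiff_const.sub hl).div (contDiff_const.add hl)
      fun p => by linarith [(hl_range p).1]).div_const _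
  have hδl : ∀ p, cayley (l p) = (e - 1) * δ p := fun p => (mul_div_cancel₀ _ he.ne').symm
  have hg := contDiffOn_axisSpeed hρ hδ hρs hδs
  have hgpos : ∀ z ∈ Mset m, 0 < axisSpeed ρ δ z := fun z => axisSpeed_pos hρ hδ
  set F := properHamiltonian (axisSpeed ρ δ)
  have hF : ContDiffOn ℝ (⊤ : ℕ∞) F (Mset m) := contDiffOn_properHamiltonian hg
  have hF0 : ∀ z ∈ Mset m, F z = 0 ↔ z.2.2 = 0 := fun z hz =>
    properHamiltonian_eq_zero_iff hz (hgpos z hz)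
  have hX : ∀ z ∈ Mset m, z.2.2 = 0 → hamVF F z = (0, axisSpeed ρ δ z, 0) := fun z =>
    hamVF_properHamiltonian hg
  have hFd : ∀ z ∈ Mset m, DifferentiableAt ℝ F z := fun z hz =>
    (hF.contDiffAt (isOpen_Mset.mem_nhds hz)).differentiableAt (by simp)
  have hfwd : ∀ z ∈ Mset m \ Z, ∃ γ w, IsFlowLine (hamVF F) (Mset m) γ z w := by
    rintro ⟨p, x, y⟩ ⟨hz, hzZ⟩
    by_cases h0 : F (p, x, y) = 0
    · obtain rfl : y = 0 := (hF0 _ hz).1 h0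
      obtain ⟨γ, x', h, -⟩ := exists_isFlowLine_axis (X := hamVF F) (ε := -1) hρ hδ
        (fun z hz hy => by rw [hX z hz hy, neg_neg, one_mul]) p hz (by
          rcases (hρ p).eq_or_lt with hp | hp
          · right
            intro t ht
            have hxl : x < l p := by
              by_contra! hle
              exact hzZ (hZ ▸ ⟨hz, (hρC p).1 hp.symm, hle, rfl⟩)
            have hlt := cayley_lt_cayley hz.1 hxl
            rw [hδl] at hlt
            have hexp : Real.exp (-1) ≤ Real.exp (-1 * t) := Real.exp_le_exp.2 (by linarith [ht.2])
            have hone : Real.exp (-1) * e = 1 := by rw [← Real.exp_add]; simp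
            have hpos := Real.exp_pos (-1)
            have hcx := cayley_pos hz
            calc δ p = Real.exp (-1) * (e * δ p) := by rw [← mul_assoc, hone, one_mul]
              _ < Real.exp (-1) * (cayley x + δ p) := by
                refine mul_lt_mul_of_pos_left ?_ hpos
                linarith
              _ ≤ _ := mul_le_mul_of_nonneg_right hexp (by linarith [hδ p])
          · exact .inl hp)
      exact ⟨γ, _, h⟩
    · exact exists_isFlowLine_of_ne_zero isOpen_Mset hF
        (fun c hc => isCompact_properHamiltonian hg hc) hz h0
  have hbwd : ∀ z ∈ Mset m, ∃ γ, ∃ w ∈ Mset m \ Z,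
      IsFlowLine (hamVF fun x => -F x) (Mset m) γ z w := by
    rintro ⟨p, x, y⟩ hz
    by_cases h0 : F (p, x, y) = 0
    · obtain rfl : y = 0 := (hF0 _ hz).1 h0
      have hcx := cayley_pos hz
      obtain ⟨γ, x', h, hx'⟩ := exists_isFlowLine_axis (X := hamVF fun x => -F x) (ε := 1) hρ hδ
        (fun z hz hy => by simp [hamVF_neg, hX z hz hy]) p hz (.inr fun t ht => by
          nlinarith [hδ p, Real.one_le_exp (by linarith [ht.1] : 0 ≤ 1 * t)])
      refine ⟨γ, _, ⟨h.finish_mem, fun hmem => ?_⟩, h⟩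
      rw [hZ] at hmem
      obtain ⟨-, hpC, hle, -⟩ := hmem
      have h1 := hx' ((hρC p).2 hpC)
      have h2 := cayley_le_cayley (hl_range p).1 hle
      rw [hδl] at h2
      have : 0 < e * cayley x := by positivity
      change cayley x' + δ p = e * (cayley x + δ p) at h1
      linarith
    · obtain ⟨γ, w, h⟩ := exists_isFlowLine_of_ne_zero (F := fun x => -F x) isOpen_Mset hF.neg
        (fun c hc => by simpa only [abs_neg] using isCompact_properHamiltonian hg hc) hz
        (neg_ne_zero.2 h0)
      refine ⟨γ, w, ⟨h.finish_mem, fun hmem => h0 ?_⟩, h⟩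
      have hcons := hamiltonian_const_of_hasDerivAt (F := fun x => -F x) (fun t ht =>
        ⟨(hFd _ (h.mem_hasDerivAt t ht).1).neg, (h.mem_hasDerivAt t ht).2⟩) 1 (by simp)
      rw [h.start, h.finish, neg_inj] at hcons
      rw [hZ] at hmem
      rw [← hcons, hF0 w hmem.1]
      exact hmem.2.2.2
  obtain ⟨φ, hφ, hφs, hbij, hψ, hsymp⟩ :=
    exists_symplectomorphism_of_isFlowLine isOpen_Mset hF hfwd hbwd
  refine ⟨F, hF, hamVF F, fun z _ w => wcan_hamVF F z w, ?_, φ, fun z hz => ?_, hφs, hbij, hψ,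
    hsymp⟩
  · intro γ T hT h0 hγ t ht
    rw [hZ] at h0 ⊢
    obtain ⟨h0M, h0C, h0l, h0y⟩ := h0
    have hcons := hamiltonian_const_of_hasDerivAt (F := F)
      fun t ht => ⟨hFd _ (hγ t ht).1, (hγ t ht).2⟩
    have hy : ∀ s ∈ Icc 0 T, (γ s).2.2 = 0 := fun s hs => by
      rw [← hF0 _ (hγ s hs).1, hcons s hs, hF0 _ h0M, h0y]
    have hd : ∀ s ∈ Icc 0 T, HasDerivAt γ (0, axisSpeed ρ δ (γ s), 0) s := fun s hs => by
      have := (hγ s hs).2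
      rwa [hX _ (hγ s hs).1 (hy s hs)] at this
    have hdp : ∀ s ∈ Icc 0 T, HasDerivAt (fun s => (γ s).1) 0 s := fun s hs =>
      (hasFDerivAt_fst (p := γ s)).comp_hasDerivAt s (hd s hs)
    have hdx : ∀ s ∈ Icc 0 T, HasDerivAt (fun s => (γ s).2.1) (axisSpeed ρ δ (γ s)) s :=
      fun s hs => by
        have h2 : HasDerivAt (fun s => (γ s).2) (axisSpeed ρ δ (γ s), 0) s :=
          (hasFDerivAt_snd (p := γ s)).comp_hasDerivAt s (hd s hs)
        exact (hasFDerivAt_fst (p := (γ s).2)).comp_hasDerivAt s h2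
    have hp : (γ t).1 = (γ 0).1 :=
      constant_of_has_deriv_right_zero
        (fun s hs => (hdp s hs).continuousAt.continuousWithinAt)
        (fun s hs => (hdp s (Ico_subset_Icc_self hs)).hasDerivWithinAt) t ht
    have hx : MonotoneOn (fun s => (γ s).2.1) (Icc 0 T) :=
      monotoneOn_of_hasDerivWithinAt_nonneg (convex_Icc 0 T)
        (fun s hs => (hdx s hs).continuousAt.continuousWithinAt)
        (fun s hs => (hdx s (interior_subset hs)).hasDerivWithinAt)
        (fun s hs => (hgpos _ (hγ s (interior_subset hs)).1).le)
    refine ⟨(hγ t ht).1, hp ▸ h0C, ?_, hy t ht⟩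
    rw [hp]
    exact h0l.trans (hx (left_mem_Icc.2 hT) ht ht.1)
  · obtain ⟨γ, h⟩ := hφ z hz
    exact ⟨γ, h.start, h.mem_hasDerivAt, h.finish⟩
end
end

section
/- There exists a family of functions u_{a,b,τ} : (0,1) → (0,1], defined for real parameters 0 < a < b < 1 and τ > 0 and jointly smooth in (a, b, τ, x) on the open set {(a,b,τ,x) : 0 < a < b < 1, τ > 0, 0 < x < 1}, such that for each such (a, b, τ): (i) u_{a,b,τ}(x) = 1 for every x ∉ (a, b); and (ii) the flow of the vector field u_{a,b,τ}(x) ∂/∂x on (0,1) takes a to b in time b − a + τ, i.e., there is a solution γ : [0, b−a+τ] → (0,1) of γ'(t) = u_{a,b,τ}(γ(t)) with γ(0) = a and γ(b−a+τ) = b. -/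
open Set

noncomputable section

namespace Real.smoothTransition

theorem differentiable_smoothTransition : Differentiable ℝ smoothTransition :=
  (smoothTransition.contDiff (n := 1)).differentiable (by norm_num)

theorem contDiff_deriv : ContDiff ℝ (⊤ : ℕ∞) (deriv smoothTransition) :=
  (contDiff_infty_iff_deriv.mp smoothTransition.contDiff).2

theorem deriv_nonneg (x : ℝ) : 0 ≤ deriv smoothTransition x :=
  smoothTransition.monotone.deriv_nonneg

theorem deriv_eq_zero_of_notMem_Ioo {x : ℝ} (hx : x ∉ Ioo (0 : ℝ) 1) :
    deriv smoothTransition x = 0 := by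
  rcases le_or_gt x 0 with h | h
  · refine IsLocalMin.deriv_eq_zero (Filter.Eventually.of_forall fun y => ?_)
    rw [zero_of_nonpos h]
    exact nonneg y
  · refine IsLocalMax.deriv_eq_zero (Filter.Eventually.of_forall fun y => ?_)
    rw [one_of_one_le (not_lt.mp fun h1 => hx ⟨h, h1⟩)]
    exact le_one y

end Real.smoothTransition

/-- The slowed-down vector field: the reciprocal of the derivative of `passageTime`. -/
def slowedField (a b τ x : ℝ) : ℝ :=
  (1 + τ * (deriv Real.smoothTransition ((x - a) / (b - a)) / (b - a)))⁻¹

/-- The time the flow of `slowedField a b τ` needs to go from `a` to `x`. -/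
def passageTime (a b τ x : ℝ) : ℝ :=
  x - a + τ * Real.smoothTransition ((x - a) / (b - a))

section

variable {a b τ : ℝ}

theorem one_le_inv_slowedField (hab : a < b) (hτ : 0 < τ) (x : ℝ) :
    1 ≤ 1 + τ * (deriv Real.smoothTransition ((x - a) / (b - a)) / (b - a)) := by
  have h := Real.smoothTransition.deriv_nonneg ((x - a) / (b - a))
  have hba : 0 < b - a := sub_pos.mpr hab
  have : 0 ≤ τ * (deriv Real.smoothTransition ((x - a) / (b - a)) / (b - a)) := by positivity
  linarith

theorem slowedField_mem_Ioc (hab : a < b) (hτ : 0 < τ) (x : ℝ) :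
    slowedField a b τ x ∈ Ioc (0 : ℝ) 1 :=
  have h := one_le_inv_slowedField hab hτ x
  ⟨inv_pos.mpr (zero_lt_one.trans_le h), inv_le_one_of_one_le₀ h⟩

theorem slowedField_eq_one (hab : a < b) {x : ℝ} (hx : x ∉ Ioo a b) :
    slowedField a b τ x = 1 := by
  have hba : 0 < b - a := sub_pos.mpr hab
  have h : (x - a) / (b - a) ∉ Ioo (0 : ℝ) 1 := fun h => hx
    ⟨by simpa [div_pos_iff_of_pos_right hba] using h.1,
      by simpa [div_lt_one hba] using h.2⟩
  simp [slowedField, Real.smoothTransition.deriv_eq_zero_of_notMem_Ioo h]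

theorem contDiffOn_slowedField :
    ContDiffOn ℝ (⊤ : ℕ∞)
      (fun q : ℝ × ℝ × ℝ × ℝ => slowedField q.1 q.2.1 q.2.2.1 q.2.2.2)
      {q : ℝ × ℝ × ℝ × ℝ | q.1 < q.2.1 ∧ 0 < q.2.2.1} := by
  have hne : ∀ q ∈ {q : ℝ × ℝ × ℝ × ℝ | q.1 < q.2.1 ∧ 0 < q.2.2.1}, q.2.1 - q.1 ≠ 0 :=
    fun q hq => (sub_pos.mpr hq.1).ne'
  have hden : ContDiff ℝ (⊤ : ℕ∞) fun q : ℝ × ℝ × ℝ × ℝ => q.2.1 - q.1 := by fun_prop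
  have harg : ContDiff ℝ (⊤ : ℕ∞) fun q : ℝ × ℝ × ℝ × ℝ => q.2.2.2 - q.1 := by fun_prop
  have hτ : ContDiff ℝ (⊤ : ℕ∞) fun q : ℝ × ℝ × ℝ × ℝ => q.2.2.1 := by fun_prop
  refine ContDiffOn.inv (contDiffOn_const.add (hτ.contDiffOn.mul
    ((Real.smoothTransition.contDiff_deriv.comp_contDiffOn
      (harg.contDiffOn.div hden.contDiffOn hne)).div hden.contDiffOn hne))) fun q hq => ?_
  exact (zero_lt_one.trans_le (one_le_inv_slowedField hq.1 hq.2 q.2.2.2)).ne'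

theorem hasDerivAt_passageTime (a b τ x : ℝ) :
    HasDerivAt (passageTime a b τ) (slowedField a b τ x)⁻¹ x := by
  have hlin : HasDerivAt (fun y : ℝ => y - a) 1 x := (hasDerivAt_id x).sub_const a
  have hS := (Real.smoothTransition.differentiable_smoothTransition
    ((x - a) / (b - a))).hasDerivAt.comp x (hlin.div_const (b - a))
  refine (hlin.add (hS.const_mul τ)).congr_deriv ?_
  rw [slowedField, inv_inv, mul_one_div]

theorem strictMono_passageTime (hab : a < b) (hτ : 0 < τ) : StrictMono (passageTime a b τ) :=
  strictMono_of_deriv_pos fun x => by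
    rw [(hasDerivAt_passageTime a b τ x).deriv]
    exact inv_pos.mpr (slowedField_mem_Ioc hab hτ x).1

theorem surjective_passageTime (hτ : 0 < τ) : Function.Surjective (passageTime a b τ) := by
  have hcont : Continuous (passageTime a b τ) :=
    continuous_iff_continuousAt.mpr fun x => (hasDerivAt_passageTime a b τ x).continuousAt
  refine hcont.surjective ?_ ?_
  · refine Filter.tendsto_atTop_mono (f := fun x => x + -a) (fun x => ?_)
      (Filter.tendsto_atTop_add_const_right _ _ Filter.tendsto_id)
    have := mul_nonneg hτ.le (Real.smoothTransition.nonneg ((x - a) / (b - a)))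
    simp only [passageTime]
    linarith
  · refine Filter.tendsto_atBot_mono (f := fun x => x + (τ - a)) (fun x => ?_)
      (Filter.tendsto_atBot_add_const_right _ _ Filter.tendsto_id)
    have := mul_le_mul_of_nonneg_left (Real.smoothTransition.le_one ((x - a) / (b - a))) hτ.le
    simp only [passageTime]
    linarith

theorem exists_integralCurve_slowedField (hab : a < b) (hτ : 0 < τ) :
    ∃ γ : ℝ → ℝ, γ 0 = a ∧ γ (b - a + τ) = b ∧ Monotone γ ∧
      ∀ t, HasDerivAt γ (slowedField a b τ (γ t)) t := by
  let e := (strictMono_passageTime hab hτ).orderIsoOfSurjective _ (surjective_passageTime hτ)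
  have he : ∀ x, e x = passageTime a b τ x := fun _ => rfl
  refine ⟨e.symm, ?_, ?_, e.symm.monotone, fun t => ?_⟩
  · rw [e.symm_apply_eq, he]
    simp [passageTime]
  · rw [e.symm_apply_eq, he]
    simp [passageTime, div_self (sub_pos.mpr hab).ne']
  · have h := HasDerivAt.of_local_left_inverse e.symm.continuous.continuousAt
      (hasDerivAt_passageTime a b τ (e.symm t))
      (inv_ne_zero (slowedField_mem_Ioc hab hτ _).1.ne')
      (Filter.Eventually.of_forall e.apply_symm_apply)
    rwa [inv_inv] at h

end

/-- There is a family `u_{a,b,τ} : (0,1) → (0,1]`, jointly smooth in `(a,b,τ,x)` on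
`{0 < a < b < 1, τ > 0, 0 < x < 1}`, such that `u_{a,b,τ} = 1` outside `(a,b)` and the
flow of `u_{a,b,τ}(x) ∂/∂x` on `(0,1)` takes `a` to `b` in time `b - a + τ`. -/
theorem exists_slowing_family :
    ∃ u : ℝ → ℝ → ℝ → ℝ → ℝ,
      ContDiffOn ℝ (⊤ : ℕ∞) (fun q : ℝ × ℝ × ℝ × ℝ => u q.1 q.2.1 q.2.2.1 q.2.2.2)
        {q : ℝ × ℝ × ℝ × ℝ |
          0 < q.1 ∧ q.1 < q.2.1 ∧ q.2.1 < 1 ∧ 0 < q.2.2.1 ∧ q.2.2.2 ∈ Ioo (0:ℝ) 1} ∧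
      ∀ a b τ : ℝ, 0 < a → a < b → b < 1 → 0 < τ →
        (∀ x ∈ Ioo (0:ℝ) 1, u a b τ x ∈ Ioc (0:ℝ) 1) ∧
        (∀ x ∈ Ioo (0:ℝ) 1, x ∉ Ioo a b → u a b τ x = 1) ∧
        (∃ γ : ℝ → ℝ, γ 0 = a ∧ γ (b - a + τ) = b ∧
          ∀ t ∈ Icc (0:ℝ) (b - a + τ),
            γ t ∈ Ioo (0:ℝ) 1 ∧ HasDerivAt γ (u a b τ (γ t)) t) := by
  refine ⟨slowedField, contDiffOn_slowedField.mono fun q hq => ⟨hq.2.1, hq.2.2.2.1⟩,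
    fun a b τ ha hab hb hτ => ⟨fun x _ => slowedField_mem_Ioc hab hτ x,
      fun x _ hx => slowedField_eq_one hab hx, ?_⟩⟩
  obtain ⟨γ, h0, h1, hmono, hγ⟩ := exists_integralCurve_slowedField hab hτ
  refine ⟨γ, h0, h1, fun t ht => ⟨⟨?_, ?_⟩, hγ t⟩⟩
  · exact ha.trans_le (h0 ▸ hmono ht.1)
  · exact (h1 ▸ hmono ht.2).trans_lt hb
end
end

section
/- Let n ≥ 2 and let Z ⊂ ℝ^{2n} be the 'box with a tail': Z = ([−1,1]^{2n-2} × [0,∞) × {0}) ∪ ({0}^{2n-2} × [−1,∞) × {0}), where [0,∞) and [−1,∞) lie in the x_n-coordinate and {0} in the y_n-coordinate. Then Z is time-independent Hamiltonian excisable from (ℝ^{2n}, ω_can): there exists a smooth F : ℝ^{2n} → ℝ such that every forward trajectory of the flow of X_F starting in Z stays in Z as long as it is defined, the maximal integral curve of X_F starting at any z ∈ ℝ^{2n} ∖ Z is defined at least on [0,1], and the time-1 flow map of X_F is a symplectomorphism from ℝ^{2n} ∖ Z onto ℝ^{2n}. -/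
open Set

noncomputable section

/-- The "box with a tail"
`Z = ([-1,1]^{2n-2} × [0,∞) × {0}) ∪ ({0}^{2n-2} × [-1,∞) × {0})`. -/
def boxWithTail (m : ℕ) : Set (EE m) :=
  {z | (∀ i, z.1.1 i ∈ Icc (-1 : ℝ) 1) ∧ (∀ i, z.1.2 i ∈ Icc (-1 : ℝ) 1) ∧
        0 ≤ z.2.1 ∧ z.2.2 = 0} ∪
  {z | z.1 = 0 ∧ -1 ≤ z.2.1 ∧ z.2.2 = 0}

universe u

section SmoothInverse

variable {E F : Type*} [NormedAddCommGroup E] [NormedSpace ℝ E] [NormedAddCommGroup F]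
  [NormedSpace ℝ F]

/-- A left inverse of a smooth map on an open set is smooth at the image of every point at which
the derivative is invertible. -/
theorem contDiffAt_of_leftInvOn [CompleteSpace E] {f : E → F} {g : F → E} {U : Set E}
    (hU : IsOpen U) (hg : LeftInvOn g f U) {x : E} (hx : x ∈ U)
    (hf : ContDiffAt ℝ (⊤ : ℕ∞) f x) {f' : E ≃L[ℝ] F} (hf' : HasFDerivAt f (f' : E →L[ℝ] F) x) :
    ContDiffAt ℝ (⊤ : ℕ∞) g (f x) := by
  have hn : ((⊤ : ℕ∞) : WithTop ℕ∞) ≠ 0 := by simp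
  have hs := hf.hasStrictFDerivAt' hf' hn
  refine (hf.to_localInverse hf' hn).congr_of_eventuallyEq ?_
  have h1 := hs.localInverse_continuousAt
  have h2 := hs.eventually_right_inverse
  have h3 : ∀ᶠ y in nhds (f x), hs.localInverse f f' x y ∈ U := by
    apply h1.eventually
    rw [hs.localInverse_apply_image]
    exact hU.mem_nhds hx
  filter_upwards [h2, h3] with y hy hyU
  have := hg hyU
  rw [hy] at this
  exact this

/-- Fixed points of a smooth family of uniform contractions depend smoothly on the parameter. -/
theorem contDiffOn_fixedPoint [CompleteSpace E] [CompleteSpace F] {T : E × F → F}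
    (hT : ContDiff ℝ (⊤ : ℕ∞) T) {U : Set E} (hU : IsOpen U) {κ : E → NNReal}
    (hκ : ∀ x ∈ U, κ x < 1) (hl : ∀ x ∈ U, LipschitzWith (κ x) fun y ↦ T (x, y)) {g : E → F}
    (hg : ∀ x ∈ U, T (x, g x) = g x) : ContDiffOn ℝ (⊤ : ℕ∞) g U := by
  set Ψ : E × F → E × F := fun z ↦ (z.1, z.2 - T z) with hΨ
  have hΨs : ContDiff ℝ (⊤ : ℕ∞) Ψ := contDiff_fst.prodMk (contDiff_snd.sub hT)
  have hinj : InjOn Ψ (U ×ˢ univ) := by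
    rintro ⟨x, y⟩ ⟨hx, -⟩ ⟨x', y'⟩ - h
    simp only [hΨ, Prod.mk.injEq] at h
    obtain ⟨rfl, h⟩ := h
    have h1 : y - y' = T (x, y) - T (x, y') := by
      rw [sub_eq_sub_iff_sub_eq_sub] at h
      exact h
    have h2 := (hl x hx).dist_le_mul y y'
    rw [dist_eq_norm, dist_eq_norm, ← h1] at h2
    have h3 : (κ x : ℝ) < 1 := by exact_mod_cast hκ x hx
    have h4 : ‖y - y'‖ = 0 := by nlinarith [norm_nonneg (y - y')]
    rw [norm_eq_zero, sub_eq_zero] at h4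
    rw [h4]
  have hopen : IsOpen (U ×ˢ (univ : Set F)) := hU.prod isOpen_univ
  intro x hx
  have hleft : LeftInvOn (Function.invFunOn Ψ (U ×ˢ univ)) Ψ (U ×ˢ univ) := hinj.leftInvOn_invFunOn
  have key : ∀ x ∈ U, g x = (Function.invFunOn Ψ (U ×ˢ univ) (x, 0)).2 := by
    intro x hx
    have h := hleft (show (x, g x) ∈ U ×ˢ univ from ⟨hx, trivial⟩)
    simp only [hΨ, hg x hx, sub_self] at h
    rw [← hΨ] at h
    rw [h]
  have hTd : HasFDerivAt T (fderiv ℝ T (x, g x)) (x, g x) :=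
    (hT.differentiable (by simp) _).hasFDerivAt
  set T' := fderiv ℝ T (x, g x)
  set M : F →L[ℝ] F := T'.comp (ContinuousLinearMap.inr ℝ E F)
  have hM : HasFDerivAt (fun y ↦ T (x, y)) M (g x) := by
    have h : HasFDerivAt (fun y : F ↦ (x, y)) (ContinuousLinearMap.inr ℝ E F) (g x) :=
      hasFDerivAt_prodMk_right x (g x)
    exact hTd.comp (g x) h
  have hMn : ‖M‖ < 1 :=
    (hM.le_of_lipschitz (hl x hx)).trans_lt (by exact_mod_cast hκ x hx)
  obtain ⟨u, hu⟩ := isUnit_one_sub_of_norm_lt_one hMn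
  have hu1 : ∀ y, (↑u⁻¹ : F →L[ℝ] F) (y - M y) = y := fun y ↦ by
    have h : ((↑u⁻¹ : F →L[ℝ] F) * (↑u : F →L[ℝ] F)) y = y := by simp
    rw [hu] at h
    simpa using h
  have hu2 : ∀ y, (↑u⁻¹ : F →L[ℝ] F) y - M ((↑u⁻¹ : F →L[ℝ] F) y) = y := fun y ↦ by
    have h : ((↑u : F →L[ℝ] F) * (↑u⁻¹ : F →L[ℝ] F)) y = y := by simp
    rw [hu] at h
    simpa using h
  set L : E × F →L[ℝ] E × F := (ContinuousLinearMap.fst ℝ E F).prod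
    (ContinuousLinearMap.snd ℝ E F - T') with hLdef
  have hLd : HasFDerivAt Ψ L (x, g x) := hasFDerivAt_fst.prodMk (hasFDerivAt_snd.sub hTd)
  have hsplit : ∀ a b, T' (a, b) = T' (a, 0) + M b := fun a b ↦ by
    simp only [M, ContinuousLinearMap.comp_apply, ContinuousLinearMap.inr_apply, ← map_add]
    simp
  have hker : (L : E × F →ₗ[ℝ] E × F).ker = ⊥ := by
    rw [LinearMap.ker_eq_bot']
    rintro ⟨a, b⟩ h
    simp only [hLdef, ContinuousLinearMap.coe_coe, ContinuousLinearMap.prod_apply,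
      ContinuousLinearMap.coe_fst', sub_apply, ContinuousLinearMap.coe_snd',
      Prod.mk_eq_zero] at h
    obtain ⟨rfl, h⟩ := h
    rw [hsplit] at h
    have hz : ((0 : E), (0 : F)) = 0 := rfl
    rw [hz, map_zero, zero_add] at h
    have := hu1 b
    rw [h, map_zero] at this
    simp [← this]
  have hran : (L : E × F →ₗ[ℝ] E × F).range = ⊤ := by
    rw [LinearMap.range_eq_top]
    rintro ⟨a, b⟩
    refine ⟨(a, (↑u⁻¹ : F →L[ℝ] F) (b + T' (a, 0))), ?_⟩
    simp only [hLdef, ContinuousLinearMap.coe_coe, ContinuousLinearMap.prod_apply,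
      ContinuousLinearMap.coe_fst', sub_apply, ContinuousLinearMap.coe_snd',
      Prod.mk.injEq, true_and]
    rw [hsplit a ((↑u⁻¹ : F →L[ℝ] F) _), sub_add_eq_sub_sub, sub_right_comm, hu2, add_sub_cancel_right]
  have hinv := contDiffAt_of_leftInvOn hopen hleft (x := (x, g x)) ⟨hx, trivial⟩ hΨs.contDiffAt
    (f' := ContinuousLinearEquiv.ofBijective L hker hran) (by
      rw [ContinuousLinearEquiv.coe_ofBijective]; exact hLd)
  have hval : Ψ (x, g x) = (x, 0) := by simp [hΨ, hg x hx]
  rw [hval] at hinv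
  have h0 : ContDiffAt ℝ (⊤ : ℕ∞) (fun x : E ↦ (x, (0 : F))) x :=
    contDiffAt_id.prodMk contDiffAt_const
  have := (hinv.comp x h0).snd
  exact (this.contDiffWithinAt).congr key (key x hx)

end SmoothInverse

section Nemytskii

/-- Pointwise application of a continuous family of operators to a continuous family of vectors. -/
def ContinuousMap.applyCLM (K : Type*) [TopologicalSpace K] [CompactSpace K] (E F : Type*)
    [NormedAddCommGroup E] [NormedSpace ℝ E] [NormedAddCommGroup F] [NormedSpace ℝ F] :
    C(K, E →L[ℝ] F) →L[ℝ] C(K, E) →L[ℝ] C(K, F) :=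
  LinearMap.mkContinuous₂
    (LinearMap.mk₂ ℝ (fun (A : C(K, E →L[ℝ] F)) (γ : C(K, E)) ↦
        (⟨fun t ↦ A t (γ t), by fun_prop⟩ : C(K, F)))
      (fun _ _ _ ↦ by ext; simp) (fun _ _ _ ↦ by ext; simp) (fun _ _ _ ↦ by ext; simp)
      (fun _ _ _ ↦ by ext; simp)) 1 (fun A γ ↦ by
    rw [one_mul]
    refine (ContinuousMap.norm_le _ (by positivity)).2 fun t ↦ ?_
    exact ((A t).le_opNorm _).trans (mul_le_mul (A.norm_coe_le_norm t) (γ.norm_coe_le_norm t)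
      (norm_nonneg _) (norm_nonneg A)))

theorem ContinuousMap.applyCLM_apply {K : Type*} [TopologicalSpace K] [CompactSpace K]
    {E F : Type*} [NormedAddCommGroup E] [NormedSpace ℝ E] [NormedAddCommGroup F]
    [NormedSpace ℝ F] (A : C(K, E →L[ℝ] F)) (γ : C(K, E)) (t : K) :
    ContinuousMap.applyCLM K E F A γ t = A t (γ t) := rfl

variable {K : Type*} [TopologicalSpace K] [CompactSpace K]

theorem hasFDerivAt_postcomp {E F : Type*} [NormedAddCommGroup E] [NormedSpace ℝ E]
    [NormedAddCommGroup F] [NormedSpace ℝ F] (f : C(E, F)) (f' : C(E, E →L[ℝ] F))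
    (hf : ∀ x, HasFDerivAt f (f' x) x) (γ : C(K, E)) :
    HasFDerivAt (fun γ : C(K, E) ↦ f.comp γ) (ContinuousMap.applyCLM K E F (f'.comp γ)) γ := by
  rw [hasFDerivAt_iff_isLittleO, Asymptotics.isLittleO_iff]
  intro ε hε
  have hc : Continuous (fun γ : C(K, E) ↦ f'.comp γ) := ContinuousMap.continuous_postcomp f'
  obtain ⟨δ, hδ, H⟩ := (Metric.continuous_iff (f := fun γ : C(K, E) ↦ f'.comp γ)).1 hc γ ε hε
  filter_upwards [Metric.ball_mem_nhds γ hδ] with η hη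
  refine (ContinuousMap.norm_le _ (by positivity)).2 fun t ↦ ?_
  have hη' : ‖η - γ‖ < δ := by rwa [← dist_eq_norm]
  have ht : ‖(η - γ) t‖ ≤ ‖η - γ‖ := ContinuousMap.norm_coe_le_norm _ t
  have hb : ∀ u ∈ Metric.ball (γ t) δ, ‖f' u - f' (γ t)‖ ≤ ε := by
    intro u hu
    have h1 : dist (γ + ContinuousMap.const K (u - γ t)) γ < δ := by
      rw [dist_eq_norm, add_sub_cancel_left]
      refine lt_of_le_of_lt ((ContinuousMap.norm_le _ (norm_nonneg (u - γ t))).2 fun s ↦ ?_)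
        (by rwa [mem_ball_iff_norm] at hu)
      simp
    have h2 := H _ h1
    have h3 := (ContinuousMap.dist_apply_le_dist t).trans h2.le
    rw [dist_eq_norm] at h3
    simpa using h3
  have := Convex.norm_image_sub_le_of_norm_hasFDerivWithin_le' (f := f) (f' := f')
    (s := Metric.ball (γ t) δ) (φ := f' (γ t)) (C := ε) (x := γ t) (y := η t)
    (fun x _ ↦ (hf x).hasFDerivWithinAt) hb (convex_ball _ _) (Metric.mem_ball_self hδ)
    (by rw [mem_ball_iff_norm]; exact ht.trans_lt hη')
  refine le_trans ?_ (this.trans (mul_le_mul_of_nonneg_left ht hε.le))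
  simp [ContinuousMap.applyCLM_apply]

/-- Composition with a smooth map is a smooth operation on continuous maps on a compact space. -/
theorem contDiff_postcomp_nat {E : Type u} [NormedAddCommGroup E] [NormedSpace ℝ E] (n : ℕ) :
    ∀ {F : Type u} [NormedAddCommGroup F] [NormedSpace ℝ F] (f : C(E, F)), ContDiff ℝ n f →
      ContDiff ℝ n (fun γ : C(K, E) ↦ f.comp γ) := by
  induction n with
  | zero =>
    intro F _ _ f _
    rw [CharP.cast_eq_zero, contDiff_zero]
    exact ContinuousMap.continuous_postcomp f
  | succ n ih =>
    intro F _ _ f hf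
    rw [Nat.cast_add, Nat.cast_one, contDiff_succ_iff_hasFDerivAt] at hf ⊢
    obtain ⟨f', hf's, hf'⟩ := hf
    refine ⟨fun γ ↦ ContinuousMap.applyCLM K E F ((⟨f', hf's.continuous⟩ : C(E, _)).comp γ), ?_,
      hasFDerivAt_postcomp f _ hf'⟩
    exact (ContinuousMap.applyCLM K E F).contDiff.comp (ih (⟨f', hf's.continuous⟩ : C(E, _)) hf's)

theorem contDiff_postcomp {E F : Type u} [NormedAddCommGroup E] [NormedSpace ℝ E]
    [NormedAddCommGroup F] [NormedSpace ℝ F] (f : C(E, F)) (hf : ContDiff ℝ (⊤ : ℕ∞) f) :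
    ContDiff ℝ (⊤ : ℕ∞) (fun γ : C(K, E) ↦ f.comp γ) :=
  contDiff_infty.2 fun n ↦ contDiff_postcomp_nat n f (contDiff_infty.1 hf n)

end Nemytskii

section Flow

open scoped Topology

/-- The primitive vanishing at `0`, as a continuous linear operator on continuous maps on
`[0, 1]`. -/
def primitiveCLM (E : Type*) [NormedAddCommGroup E] [NormedSpace ℝ E] [CompleteSpace E] :
    C(Icc (0 : ℝ) 1, E) →L[ℝ] C(Icc (0 : ℝ) 1, E) :=
  LinearMap.mkContinuous
    { toFun := fun γ ↦ ⟨fun t ↦ ∫ x in (0 : ℝ)..t, γ (projIcc 0 1 zero_le_one x), by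
        have h : Continuous fun x : ℝ ↦ γ (projIcc 0 1 zero_le_one x) :=
          γ.continuous.comp continuous_projIcc
        exact (intervalIntegral.continuous_primitive
          (fun a b ↦ h.intervalIntegrable a b) 0).comp continuous_subtype_val⟩
      map_add' := fun γ η ↦ by
        ext t
        have h : ∀ γ : C(Icc (0 : ℝ) 1, E),
            Continuous fun x : ℝ ↦ γ (projIcc 0 1 zero_le_one x) := fun γ ↦
          γ.continuous.comp continuous_projIcc
        exact intervalIntegral.integral_add ((h γ).intervalIntegrable _ _)
          ((h η).intervalIntegrable _ _)
      map_smul' := fun c γ ↦ by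
        ext t
        exact intervalIntegral.integral_smul c _ } 1 fun γ ↦ by
    rw [one_mul]
    refine (ContinuousMap.norm_le _ (norm_nonneg γ)).2 fun t ↦ ?_
    have := intervalIntegral.norm_integral_le_of_norm_le_const (a := 0) (b := (t : ℝ))
      (f := fun x : ℝ ↦ γ (projIcc 0 1 zero_le_one x)) (C := ‖γ‖)
      fun x _ ↦ γ.norm_coe_le_norm _
    refine this.trans ?_
    rw [sub_zero, abs_of_nonneg t.2.1]
    exact mul_le_of_le_one_right (norm_nonneg γ) t.2.2

theorem norm_primitiveCLM_le {E : Type*} [NormedAddCommGroup E] [NormedSpace ℝ E]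
    [CompleteSpace E] : ‖primitiveCLM E‖ ≤ 1 :=
  LinearMap.mkContinuous_norm_le _ zero_le_one _

/-- Bounded Lipschitz vector fields have global integral curves. -/
theorem exists_global_integralCurve {E : Type*} [NormedAddCommGroup E] [NormedSpace ℝ E]
    [CompleteSpace E] {v : E → E} {K L : NNReal} (hK : LipschitzWith K v) (hL : ∀ x, ‖v x‖ ≤ L)
    (p : E) : ∃ γ : ℝ → E, γ 0 = p ∧ ∀ t, HasDerivAt γ (v (γ t)) t := by
  have hloc : ∀ T : NNReal, ∃ α : ℝ → E, α 0 = p ∧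
      ∀ t ∈ Ioo (-T : ℝ) T, HasDerivAt α (v (α t)) t := by
    intro T
    have hT : (0 : ℝ) ∈ Icc (-T : ℝ) T := ⟨by simp, T.2⟩
    have hpl : IsPicardLindelof (fun _ ↦ v) (⟨0, hT⟩ : Icc (-T : ℝ) T) p (L * T) 0 L K :=
      IsPicardLindelof.of_time_independent (fun x _ ↦ hL x) hK.lipschitzOnWith (by simp)
    obtain ⟨α, h0, hα⟩ := hpl.exists_eq_forall_mem_Icc_hasDerivWithinAt₀
    exact ⟨α, h0, fun t ht ↦ (hα t (Ioo_subset_Icc_self ht)).hasDerivAt (Icc_mem_nhds ht.1 ht.2)⟩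
  choose α h0 hα using hloc
  have huniq : ∀ (S T : NNReal) (t : ℝ), |t| < S → |t| < T → α S t = α T t := by
    intro S T t hS hT
    rw [abs_lt] at hS hT
    have hpos : ∀ a : ℝ, -a < t → t < a → 0 < a := fun a h1 h2 ↦ by linarith
    refine ODE_solution_unique_of_mem_Ioo (v := fun _ ↦ v) (s := fun _ ↦ univ) (K := K)
      (a := max (-S : ℝ) (-T)) (b := min (S : ℝ) T) (t₀ := 0) (fun _ _ ↦ hK.lipschitzOnWith)
      ?_ (fun s hs ↦ ⟨hα S s ?_, trivial⟩) (fun s hs ↦ ⟨hα T s ?_, trivial⟩)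
      ((h0 S).trans (h0 T).symm) ⟨max_lt hS.1 hT.1, lt_min hS.2 hT.2⟩
    · have := hpos _ hS.1 hS.2
      have := hpos _ hT.1 hT.2
      exact ⟨max_lt (by linarith) (by linarith), lt_min (by linarith) (by linarith)⟩
    · exact ⟨(le_max_left _ _).trans_lt hs.1, hs.2.trans_le (min_le_left _ _)⟩
    · exact ⟨(le_max_right _ _).trans_lt hs.1, hs.2.trans_le (min_le_right _ _)⟩
  have hlt : ∀ t : ℝ, |t| < ((‖t‖₊ + 1 : NNReal) : ℝ) := fun t ↦ by simp
  refine ⟨fun t ↦ α (‖t‖₊ + 1) t, h0 _, fun t ↦ ?_⟩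
  refine (hα (‖t‖₊ + 1) t (abs_lt.1 (hlt t))).congr_of_eventuallyEq ?_
  filter_upwards [continuous_abs.continuousAt.eventually (gt_mem_nhds (hlt t))] with s hs
  exact huniq _ _ s (hlt s) hs

theorem integralCurve_unique {E : Type*} [NormedAddCommGroup E] [NormedSpace ℝ E]
    {v : E → E} {K : NNReal} (hK : LipschitzWith K v) {γ η : ℝ → E}
    (hγ : ∀ t, HasDerivAt γ (v (γ t)) t) (hη : ∀ t, HasDerivAt η (v (η t)) t) (h : γ 0 = η 0) :
    γ = η :=
  ODE_solution_unique_univ (v := fun _ ↦ v) (s := fun _ ↦ univ) (K := K)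
    (fun _ ↦ hK.lipschitzOnWith) (fun t ↦ ⟨hγ t, trivial⟩) (fun t ↦ ⟨hη t, trivial⟩) h

theorem flow_add {E : Type*} [NormedAddCommGroup E] [NormedSpace ℝ E]
    {v : E → E} {K : NNReal} (hK : LipschitzWith K v) {σ : ℝ × E → E} (h0 : ∀ p, σ (0, p) = p)
    (hσ : ∀ p t, HasDerivAt (fun t ↦ σ (t, p)) (v (σ (t, p))) t) (t u : ℝ) (p : E) :
    σ (t + u, p) = σ (t, σ (u, p)) := by
  have h := integralCurve_unique hK (γ := fun t ↦ σ (t + u, p)) (η := fun t ↦ σ (t, σ (u, p)))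
    (fun t ↦ (hσ p (t + u)).comp_add_const t u) (fun t ↦ hσ _ t) (by simp [h0])
  exact congrFun h t

/-- The flow of a smooth vector field is smooth for short times. -/
theorem contDiffOn_flow_short {E : Type u} [NormedAddCommGroup E] [NormedSpace ℝ E]
    [CompleteSpace E] {v : E → E} (hv : ContDiff ℝ (⊤ : ℕ∞) v) {K : NNReal}
    (hK : LipschitzWith K v) {σ : ℝ × E → E} (h0 : ∀ p, σ (0, p) = p)
    (hσ : ∀ p t, HasDerivAt (fun t ↦ σ (t, p)) (v (σ (t, p))) t) :
    ContDiffOn ℝ (⊤ : ℕ∞) σ {z | ‖z.1‖₊ * K < 1} := by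
  have hc : ∀ p, Continuous fun t ↦ σ (t, p) := fun p ↦
    continuous_iff_continuousAt.2 fun t ↦ (hσ p t).continuousAt
  let V : C(E, E) := ⟨v, hv.continuous⟩
  let T : (ℝ × E) × C(Icc (0 : ℝ) 1, E) → C(Icc (0 : ℝ) 1, E) := fun z ↦
    ContinuousLinearMap.const ℝ (Icc (0 : ℝ) 1) z.1.2 + z.1.1 • primitiveCLM E (V.comp z.2)
  let Γ : ℝ × E → C(Icc (0 : ℝ) 1, E) := fun z ↦
    ⟨fun t ↦ σ (z.1 * t, z.2), (hc z.2).comp (by fun_prop)⟩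
  have hT : ContDiff ℝ (⊤ : ℕ∞) T := by
    have h1 : ContDiff ℝ (⊤ : ℕ∞) fun γ : C(Icc (0 : ℝ) 1, E) ↦ V.comp γ := contDiff_postcomp V hv
    have h2 : ContDiff ℝ (⊤ : ℕ∞) fun z : (ℝ × E) × C(Icc (0 : ℝ) 1, E) ↦ z.1.2 :=
      contDiff_fst.snd
    have h3 : ContDiff ℝ (⊤ : ℕ∞) fun z : (ℝ × E) × C(Icc (0 : ℝ) 1, E) ↦ z.1.1 :=
      contDiff_fst.fst
    exact ((ContinuousLinearMap.const ℝ (Icc (0 : ℝ) 1)).contDiff.comp h2).add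
      (h3.smul ((primitiveCLM E).contDiff.comp (h1.comp contDiff_snd)))
  have hVl : LipschitzWith K fun γ : C(Icc (0 : ℝ) 1, E) ↦ V.comp γ := by
    refine LipschitzWith.of_dist_le_mul fun γ η ↦ ?_
    refine (ContinuousMap.dist_le (by positivity)).2 fun t ↦ ?_
    exact (hK.dist_le_mul _ _).trans
      (mul_le_mul_of_nonneg_left (ContinuousMap.dist_apply_le_dist t) K.2)
  have hU : IsOpen {z : ℝ × E | ‖z.1‖₊ * K < 1} :=
    isOpen_lt (by fun_prop) continuous_const
  have hΓ : ContDiffOn ℝ (⊤ : ℕ∞) Γ {z | ‖z.1‖₊ * K < 1} := by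
    refine contDiffOn_fixedPoint hT hU (κ := fun z ↦ ‖z.1‖₊ * K) (fun z hz ↦ hz) ?_ ?_
    · rintro ⟨a, p⟩ -
      refine LipschitzWith.of_dist_le_mul fun γ η ↦ ?_
      have h1 : T ((a, p), γ) - T ((a, p), η) = a • primitiveCLM E (V.comp γ - V.comp η) := by
        simp only [T, map_sub, smul_sub]
        abel
      rw [dist_eq_norm, h1, norm_smul]
      have h2 := (primitiveCLM E).le_of_opNorm_le norm_primitiveCLM_le (V.comp γ - V.comp η)
      have h3 := hVl.dist_le_mul γ η
      rw [dist_eq_norm (V.comp γ)] at h3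
      rw [one_mul] at h2
      push_cast
      rw [mul_assoc]
      exact mul_le_mul_of_nonneg_left (h2.trans h3) (norm_nonneg a)
    · rintro ⟨a, p⟩ -
      ext t
      have h1 : ∀ x ∈ uIcc (0 : ℝ) t,
          HasDerivAt (fun s : ℝ ↦ σ (a * s, p)) (a • v (σ (a * x, p))) x := by
        intro x _
        have h2 : HasDerivAt (fun s : ℝ ↦ a * s) a x := by
          simpa using (hasDerivAt_id x).const_mul a
        exact (hσ p (a * x)).scomp x h2
      have h2 : Continuous fun x : ℝ ↦ a • v (σ (a * x, p)) :=
        (hv.continuous.comp ((hc p).comp (by fun_prop))).const_smul a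
      have h3 := intervalIntegral.integral_eq_sub_of_hasDerivAt h1 (h2.intervalIntegrable _ _)
      have h4 : (∫ x in (0 : ℝ)..t, v (σ (a * (projIcc (0 : ℝ) 1 zero_le_one x : ℝ), p))) =
          ∫ x in (0 : ℝ)..t, v (σ (a * x, p)) := by
        refine intervalIntegral.integral_congr fun x hx ↦ ?_
        rw [uIcc_of_le t.2.1] at hx
        simp only [projIcc_of_mem zero_le_one (show x ∈ Icc (0 : ℝ) 1 from
          ⟨hx.1, hx.2.trans t.2.2⟩)]
      rw [intervalIntegral.integral_smul, mul_zero, h0] at h3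
      change p + a • (∫ x in (0 : ℝ)..t,
        v (σ (a * (projIcc (0 : ℝ) 1 zero_le_one x : ℝ), p))) = σ (a * t, p)
      rw [h4, h3]
      abel
  have h1 : σ = fun z ↦ ContinuousMap.evalCLM ℝ (⟨1, by simp⟩ : Icc (0 : ℝ) 1) (Γ z) := by
    ext ⟨a, p⟩
    simp [Γ, ContinuousMap.evalCLM]
  rw [h1]
  exact (ContinuousLinearMap.contDiff _).comp_contDiffOn hΓ

/-- Bounded Lipschitz smooth vector fields have smooth global flows. -/
theorem exists_contDiff_flow {E : Type u} [NormedAddCommGroup E] [NormedSpace ℝ E]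
    [CompleteSpace E] {v : E → E} (hv : ContDiff ℝ (⊤ : ℕ∞) v) {K L : NNReal}
    (hK : LipschitzWith K v) (hL : ∀ x, ‖v x‖ ≤ L) :
    ∃ σ : ℝ × E → E, ContDiff ℝ (⊤ : ℕ∞) σ ∧ (∀ p, σ (0, p) = p) ∧
      (∀ p t, HasDerivAt (fun t ↦ σ (t, p)) (v (σ (t, p))) t) ∧
      ∀ t u p, σ (t + u, p) = σ (t, σ (u, p)) := by
  choose γ hγ0 hγ using exists_global_integralCurve hK hL
  let σ : ℝ × E → E := fun z ↦ γ z.2 z.1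
  have h0 : ∀ p, σ (0, p) = p := hγ0
  have hσ : ∀ p t, HasDerivAt (fun t ↦ σ (t, p)) (v (σ (t, p))) t := hγ
  have hadd := flow_add hK h0 hσ
  have hshort := contDiffOn_flow_short hv hK h0 hσ
  refine ⟨σ, contDiff_iff_contDiffAt.2 fun z ↦ ?_, h0, hσ, hadd⟩
  obtain ⟨n, hn⟩ := exists_nat_gt (‖z.1‖₊ * K)
  have hn0 : (0 : NNReal) < n := zero_le.trans_lt hn
  have hn1 : (n : ℝ) ≠ 0 := by exact_mod_cast hn0.ne'
  have hU : IsOpen {z : ℝ × E | ‖z.1‖₊ * K < n} := isOpen_lt (by fun_prop) continuous_const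
  have hiter : ∀ k : ℕ, ContDiffOn ℝ (⊤ : ℕ∞) (fun z : ℝ × E ↦ σ (k * (z.1 / n), z.2))
      {z | ‖z.1‖₊ * K < n} := by
    intro k
    induction k with
    | zero => simpa [h0] using contDiff_snd.contDiffOn
    | succ k ih =>
      have h1 : (fun z : ℝ × E ↦ σ (((k + 1 : ℕ) : ℝ) * (z.1 / n), z.2)) =
          fun z ↦ σ (z.1 / n, σ (k * (z.1 / n), z.2)) := by
        ext z
        rw [← hadd]
        congr 2
        push_cast
        ring
      rw [h1]
      refine hshort.comp (((contDiff_fst.div_const (n : ℝ)).contDiffOn).prodMk ih) fun w hw ↦ ?_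
      change ‖w.1 / n‖₊ * K < 1
      rw [nnnorm_div, div_mul_eq_mul_div, div_lt_one (by simpa using hn0)]
      simpa using hw
  have h1 : (fun z : ℝ × E ↦ σ (n * (z.1 / n), z.2)) = σ := by
    ext w
    rw [mul_div_cancel₀ _ hn1]
  have := hiter n
  rw [h1] at this
  exact this.contDiffAt (hU.mem_nhds hn)

end Flow

section BaseSymplectic

/-- The standard symplectic form as a continuous bilinear form. -/
def wBL (m : ℕ) : ((Fin m → ℝ) × (Fin m → ℝ)) →L[ℝ] ((Fin m → ℝ) × (Fin m → ℝ)) →L[ℝ] ℝ :=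
  LinearMap.toContinuousBilinearMap (LinearMap.mk₂ ℝ (wB m)
    (fun _ _ _ ↦ by
      simp only [wB, Prod.fst_add, Prod.snd_add, Pi.add_apply, ← Finset.sum_add_distrib]
      exact Finset.sum_congr rfl fun _ _ ↦ by ring)
    (fun _ _ _ ↦ by
      simp only [wB, Prod.smul_fst, Prod.smul_snd, Pi.smul_apply, smul_eq_mul, Finset.mul_sum]
      exact Finset.sum_congr rfl fun _ _ ↦ by ring)
    (fun _ _ _ ↦ by
      simp only [wB, Prod.fst_add, Prod.snd_add, Pi.add_apply, ← Finset.sum_add_distrib]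
      exact Finset.sum_congr rfl fun _ _ ↦ by ring)
    (fun _ _ _ ↦ by
      simp only [wB, Prod.smul_fst, Prod.smul_snd, Pi.smul_apply, smul_eq_mul, Finset.mul_sum]
      exact Finset.sum_congr rfl fun _ _ ↦ by ring))

theorem wBL_apply (m : ℕ) (u v : (Fin m → ℝ) × (Fin m → ℝ)) : wBL m u v = wB m u v := rfl

theorem wB_neg_comm (m : ℕ) (u v : (Fin m → ℝ) × (Fin m → ℝ)) : wB m u v = -wB m v u := by
  simp only [wB, ← Finset.sum_neg_distrib]
  exact Finset.sum_congr rfl fun _ _ ↦ by ring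

theorem wB_self (m : ℕ) (u : (Fin m → ℝ) × (Fin m → ℝ)) : wB m u u = 0 := by
  have := wB_neg_comm m u u
  linarith

theorem wB_single_right (m : ℕ) (u : (Fin m → ℝ) × (Fin m → ℝ)) (i : Fin m) :
    wB m u (0, Pi.single i 1) = u.1 i := by
  simp [wB, Pi.single_apply]

theorem wB_single_left (m : ℕ) (u : (Fin m → ℝ) × (Fin m → ℝ)) (i : Fin m) :
    wB m u (Pi.single i 1, 0) = -u.2 i := by
  simp [wB, Pi.single_apply]

/-- The vector dual to a linear form under the standard symplectic form. -/
def wBDual (m : ℕ) (l : ((Fin m → ℝ) × (Fin m → ℝ)) →L[ℝ] ℝ) : (Fin m → ℝ) × (Fin m → ℝ) :=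
  (fun i ↦ l (0, Pi.single i 1), fun i ↦ -l (Pi.single i 1, 0))

theorem wB_wBDual (m : ℕ) (l : ((Fin m → ℝ) × (Fin m → ℝ)) →L[ℝ] ℝ)
    (w : (Fin m → ℝ) × (Fin m → ℝ)) : wB m (wBDual m l) w = l w := by
  have h1 : w.1 = ∑ i, w.1 i • (Pi.single i 1 : Fin m → ℝ) := by
    ext j
    simp [Finset.sum_apply, Pi.single_apply]
  have h2 : w.2 = ∑ i, w.2 i • (Pi.single i 1 : Fin m → ℝ) := by
    ext j
    simp [Finset.sum_apply, Pi.single_apply]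
  have h3 : l (w.1, 0) = ∑ i, w.1 i * l (Pi.single i 1, 0) := by
    have h : l.comp (ContinuousLinearMap.inl ℝ _ _) w.1 =
        ∑ i, w.1 i * l.comp (ContinuousLinearMap.inl ℝ _ _) (Pi.single i 1) := by
      conv_lhs => rw [h1]
      simp only [map_sum, map_smul, smul_eq_mul]
    simpa using h
  have h4 : l (0, w.2) = ∑ i, w.2 i * l (0, Pi.single i 1) := by
    have h : l.comp (ContinuousLinearMap.inr ℝ _ _) w.2 =
        ∑ i, w.2 i * l.comp (ContinuousLinearMap.inr ℝ _ _) (Pi.single i 1) := by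
      conv_lhs => rw [h2]
      simp only [map_sum, map_smul, smul_eq_mul]
    simpa using h
  have h5 : l w = l (w.1, 0) + l (0, w.2) := by
    rw [← map_add]
    simp
  rw [h5, h3, h4, ← Finset.sum_add_distrib]
  exact Finset.sum_congr rfl fun i _ ↦ by simp only [wBDual]; ring

theorem contDiff_wBDual (m : ℕ) {s : (Fin m → ℝ) × (Fin m → ℝ) → ℝ}
    (hs : ContDiff ℝ (⊤ : ℕ∞) s) : ContDiff ℝ (⊤ : ℕ∞) fun p ↦ wBDual m (fderiv ℝ s p) := by
  have h : ContDiff ℝ (⊤ : ℕ∞) (fderiv ℝ s) := hs.fderiv_right (by simp)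
  exact (contDiff_pi.2 fun i ↦ h.clm_apply contDiff_const).prodMk
    (contDiff_pi.2 fun i ↦ (h.clm_apply contDiff_const).neg)

theorem minSmoothness_two_le : minSmoothness ℝ 2 ≤ ((⊤ : ℕ∞) : WithTop ℕ∞) := by
  rw [minSmoothness_of_isRCLikeNormedField]
  exact WithTop.coe_le_coe.2 (le_top : (2 : ℕ∞) ≤ ⊤)

/-- The derivative of a smooth flow in the initial condition solves the linearised equation. -/
theorem hasDerivAt_fderiv_flow {E : Type*} [NormedAddCommGroup E] [NormedSpace ℝ E]
    {v : E → E} (hv : Differentiable ℝ v) {σ : ℝ × E → E} (hσs : ContDiff ℝ (⊤ : ℕ∞) σ)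
    (hσ : ∀ p t, HasDerivAt (fun t ↦ σ (t, p)) (v (σ (t, p))) t) (p a : E) (t : ℝ) :
    HasDerivAt (fun t ↦ fderiv ℝ σ (t, p) (0, a))
      (fderiv ℝ v (σ (t, p)) (fderiv ℝ σ (t, p) (0, a))) t := by
  have hd : Differentiable ℝ σ := hσs.differentiable (by simp)
  have hd2 : Differentiable ℝ (fderiv ℝ σ) :=
    (hσs.fderiv_right (m := (⊤ : ℕ∞)) (by simp)).differentiable (by simp)
  have htime : ∀ z : ℝ × E, fderiv ℝ σ z (1, 0) = v (σ z) := by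
    rintro ⟨r, q⟩
    have h1 : HasDerivAt (fun r : ℝ ↦ (r, q)) ((1 : ℝ), (0 : E)) r :=
      (hasDerivAt_id r).prodMk (hasDerivAt_const r q)
    exact ((hd (r, q)).hasFDerivAt.comp_hasDerivAt r h1).unique (hσ q r)
  have h1 : HasDerivAt (fun r : ℝ ↦ (r, p)) ((1 : ℝ), (0 : E)) t :=
    (hasDerivAt_id t).prodMk (hasDerivAt_const t p)
  have h2 : HasDerivAt (fun r ↦ fderiv ℝ σ (r, p) (0, a))
      (fderiv ℝ (fderiv ℝ σ) (t, p) (1, 0) (0, a)) t :=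
    (ContinuousLinearMap.apply ℝ E ((0 : ℝ), a)).hasFDerivAt.comp_hasDerivAt t
      ((hd2 (t, p)).hasFDerivAt.comp_hasDerivAt t h1)
  have hsymm : IsSymmSndFDerivAt ℝ σ (t, p) :=
    hσs.contDiffAt.isSymmSndFDerivAt minSmoothness_two_le
  have h3 : HasFDerivAt (fun z ↦ fderiv ℝ σ z ((1 : ℝ), (0 : E)))
      ((fderiv ℝ v (σ (t, p))).comp (fderiv ℝ σ (t, p))) (t, p) := by
    simp only [htime]
    exact (hv _).hasFDerivAt.comp _ (hd _).hasFDerivAt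
  have h4 : HasFDerivAt (fun z ↦ fderiv ℝ σ z ((1 : ℝ), (0 : E)))
      ((ContinuousLinearMap.apply ℝ E ((1 : ℝ), (0 : E))).comp (fderiv ℝ (fderiv ℝ σ) (t, p)))
      (t, p) :=
    (ContinuousLinearMap.apply ℝ E ((1 : ℝ), (0 : E))).hasFDerivAt.comp (t, p)
      (hd2 (t, p)).hasFDerivAt
  have h5 : fderiv ℝ v (σ (t, p)) (fderiv ℝ σ (t, p) (0, a)) =
      fderiv ℝ (fderiv ℝ σ) (t, p) (0, a) (1, 0) :=
    congrArg (fun A : ℝ × E →L[ℝ] E ↦ A (0, a)) (h3.unique h4)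
  rw [h5, ← hsymm (1, 0) (0, a)]
  exact h2

/-- Hamiltonian flows preserve the symplectic form and the Hamiltonian. -/
theorem exists_hamiltonian_flow (m : ℕ) {s : (Fin m → ℝ) × (Fin m → ℝ) → ℝ}
    (hs : ContDiff ℝ (⊤ : ℕ∞) s) (hc : HasCompactSupport (fderiv ℝ s)) :
    ∃ σ : ℝ × ((Fin m → ℝ) × (Fin m → ℝ)) → (Fin m → ℝ) × (Fin m → ℝ),
      ContDiff ℝ (⊤ : ℕ∞) σ ∧ (∀ p, σ (0, p) = p) ∧
      (∀ t u p, σ (t + u, p) = σ (t, σ (u, p))) ∧ (∀ t p, s (σ (t, p)) = s p) ∧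
      (∀ z w, wB m (fderiv ℝ σ z (1, 0)) w = fderiv ℝ s (σ z) w) ∧
      ∀ z a b, wB m (fderiv ℝ σ z (0, a)) (fderiv ℝ σ z (0, b)) = wB m a b := by
  set v := fun p ↦ wBDual m (fderiv ℝ s p) with hvdef
  have hv : ContDiff ℝ (⊤ : ℕ∞) v := contDiff_wBDual m hs
  have hvc : HasCompactSupport v := hc.comp_left (g := wBDual m) (by ext <;> simp [wBDual])
  obtain ⟨K, hK⟩ := hv.lipschitzWith_of_hasCompactSupport hvc (by simp)
  obtain ⟨C, hC⟩ := hvc.exists_bound_of_continuous hv.continuous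
  obtain ⟨σ, hσs, h0, hσ, hadd⟩ := exists_contDiff_flow hv hK (L := C.toNNReal)
    fun x ↦ (hC x).trans (Real.le_coe_toNNReal C)
  have hd : Differentiable ℝ σ := hσs.differentiable (by simp)
  have hsd : Differentiable ℝ s := hs.differentiable (by simp)
  refine ⟨σ, hσs, h0, hadd, fun t p ↦ ?_, ?_, ?_⟩
  · have h1 : ∀ t, HasDerivAt (fun t ↦ s (σ (t, p))) 0 t := fun t ↦ by
      refine ((hsd _).hasFDerivAt.comp_hasDerivAt t (hσ p t)).congr_deriv ?_
      rw [← wB_wBDual, wB_self]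
    have h2 := is_const_of_deriv_eq_zero (fun t ↦ (h1 t).differentiableAt)
      (fun t ↦ (h1 t).deriv) t 0
    simpa [h0] using h2
  · rintro ⟨t, p⟩ w
    have h1 : HasDerivAt (fun r : ℝ ↦ (r, p)) ((1 : ℝ), (0 : (Fin m → ℝ) × (Fin m → ℝ))) t :=
      (hasDerivAt_id t).prodMk (hasDerivAt_const t p)
    rw [((hd (t, p)).hasFDerivAt.comp_hasDerivAt t h1).unique (hσ p t), hvdef, wB_wBDual]
  · rintro ⟨t, p⟩ a b
    have hvd : Differentiable ℝ v := hv.differentiable (by simp)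
    have hd2 : Differentiable ℝ (fderiv ℝ s) :=
      (hs.fderiv_right (m := (⊤ : ℕ∞)) (by simp)).differentiable (by simp)
    have hlin : ∀ q a b, wB m (fderiv ℝ v q a) b = fderiv ℝ (fderiv ℝ s) q a b := by
      intro q a b
      have h1 : HasFDerivAt (fun q ↦ wBL m (v q) b) (((wBL m).flip b).comp (fderiv ℝ v q)) q :=
        ((wBL m).flip b).hasFDerivAt.comp q (hvd q).hasFDerivAt
      have h2 : (fun q ↦ wBL m (v q) b) = fun q ↦ fderiv ℝ s q b := by
        ext q
        rw [wBL_apply, hvdef, wB_wBDual]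
      rw [h2] at h1
      have h3 := (hd2 q).hasFDerivAt.clm_apply (hasFDerivAt_const b q)
      have h4 := congrArg (fun A : _ →L[ℝ] ℝ ↦ A a) (h1.unique h3)
      simpa [wBL_apply] using h4
    have h1 : ∀ t, HasDerivAt
        (fun t ↦ wBL m (fderiv ℝ σ (t, p) (0, a)) (fderiv ℝ σ (t, p) (0, b))) 0 t := fun t ↦ by
      refine ((wBL m).hasDerivAt_of_bilinear
        (fun _ ↦ hasDerivAt_fderiv_flow hvd hσs hσ p a t)
        (fun _ ↦ hasDerivAt_fderiv_flow hvd hσs hσ p b t)).congr_deriv ?_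
      have hsymm : IsSymmSndFDerivAt ℝ s (σ (t, p)) :=
        hs.contDiffAt.isSymmSndFDerivAt minSmoothness_two_le
      rw [wBL_apply, wBL_apply, wB_neg_comm, hlin, hlin, hsymm]
      ring
    have h2 := is_const_of_deriv_eq_zero (fun t ↦ (h1 t).differentiableAt)
      (fun t ↦ (h1 t).deriv) t 0
    have h3 : ∀ a, fderiv ℝ σ (0, p) (0, a) = a := fun a ↦ by
      have h4 : HasFDerivAt (fun q : (Fin m → ℝ) × (Fin m → ℝ) ↦ ((0 : ℝ), q))
        (ContinuousLinearMap.inr ℝ ℝ _) p := hasFDerivAt_prodMk_right 0 p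
      have h5 := (hd (0, p)).hasFDerivAt.comp p h4
      have h6 : (σ ∘ fun q ↦ ((0 : ℝ), q)) = id := funext h0
      rw [h6] at h5
      have h7 := congrArg (fun A : _ →L[ℝ] _ ↦ A a) (h5.unique (hasFDerivAt_id p))
      simpa using h7
    simpa only [wBL_apply, h3] using h2

end BaseSymplectic

section LevelFunction

open Real

/-- A smooth function on `ℝ^{2m}` which vanishes exactly at the origin, is at most `1` exactly on
the box `[-1, 1]^{2m}`, and is constant outside a compact set. -/
def boxLevel (m : ℕ) (p : (Fin m → ℝ) × (Fin m → ℝ)) : ℝ :=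
  smoothTransition (∑ i, (p.1 i ^ 2 + p.2 i ^ 2)) +
    smoothTransition (∑ i, (smoothTransition (p.1 i ^ 2 - 1) + smoothTransition (p.2 i ^ 2 - 1)))

theorem contDiff_boxLevel (m : ℕ) : ContDiff ℝ (⊤ : ℕ∞) (boxLevel m) := by
  have h1 : ∀ i, ContDiff ℝ (⊤ : ℕ∞) fun p : (Fin m → ℝ) × (Fin m → ℝ) ↦ p.1 i := fun i ↦
    (contDiff_apply ℝ ℝ i).comp contDiff_fst
  have h2 : ∀ i, ContDiff ℝ (⊤ : ℕ∞) fun p : (Fin m → ℝ) × (Fin m → ℝ) ↦ p.2 i := fun i ↦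
    (contDiff_apply ℝ ℝ i).comp contDiff_snd
  refine (smoothTransition.contDiff.comp ?_).add (smoothTransition.contDiff.comp ?_)
  · exact ContDiff.sum fun i _ ↦ ((h1 i).pow 2).add ((h2 i).pow 2)
  · exact ContDiff.sum fun i _ ↦ (smoothTransition.contDiff.comp
      (((h1 i).pow 2).sub contDiff_const)).add (smoothTransition.contDiff.comp
      (((h2 i).pow 2).sub contDiff_const))

theorem sum_add_pos_of_pos {ι : Type*} [Fintype ι] {f g : ι → ℝ} (hf : ∀ i, 0 ≤ f i)
    (hg : ∀ i, 0 ≤ g i) (c : ℝ) {i : ι} (h : c < f i ∨ c < g i) : c < ∑ i, (f i + g i) := by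
  have h1 := Finset.single_le_sum (f := fun i ↦ f i + g i)
    (fun j _ ↦ add_nonneg (hf j) (hg j)) (Finset.mem_univ i)
  rcases h with h | h <;> linarith [hf i, hg i]

theorem boxLevel_eq_zero_iff (m : ℕ) (p : (Fin m → ℝ) × (Fin m → ℝ)) :
    boxLevel m p = 0 ↔ p = 0 := by
  constructor
  · intro h
    have h1 : smoothTransition (∑ i, (p.1 i ^ 2 + p.2 i ^ 2)) = 0 := by
      have h2 := smoothTransition.nonneg (∑ i, (p.1 i ^ 2 + p.2 i ^ 2))
      have h3 := smoothTransition.nonneg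
        (∑ i, (smoothTransition (p.1 i ^ 2 - 1) + smoothTransition (p.2 i ^ 2 - 1)))
      unfold boxLevel at h
      linarith
    rw [smoothTransition.zero_iff_nonpos] at h1
    by_contra hp
    have h4 : ∃ i, p.1 i ≠ 0 ∨ p.2 i ≠ 0 := by
      by_contra! hall
      exact hp (Prod.ext (funext fun i ↦ (hall i).1) (funext fun i ↦ (hall i).2))
    obtain ⟨i, hi⟩ := h4
    refine h1.not_gt (sum_add_pos_of_pos (fun _ ↦ sq_nonneg _) (fun _ ↦ sq_nonneg _) 0 (i := i) ?_)
    exact hi.imp (fun h ↦ by positivity) (fun h ↦ by positivity)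
  · rintro rfl
    simp [boxLevel, smoothTransition.zero_of_nonpos (show (-1 : ℝ) ≤ 0 by norm_num)]

theorem boxLevel_le_one_iff (m : ℕ) (p : (Fin m → ℝ) × (Fin m → ℝ)) :
    boxLevel m p ≤ 1 ↔ (∀ i, p.1 i ∈ Icc (-1 : ℝ) 1) ∧ ∀ i, p.2 i ∈ Icc (-1 : ℝ) 1 := by
  have hsq : ∀ x : ℝ, x ∈ Icc (-1 : ℝ) 1 ↔ x ^ 2 ≤ 1 := fun x ↦ by
    rw [sq_le_one_iff_abs_le_one, abs_le, mem_Icc]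
  simp only [hsq]
  constructor
  · intro h
    by_contra hp
    have h4 : ∃ i, 1 < p.1 i ^ 2 ∨ 1 < p.2 i ^ 2 := by
      by_contra! hall
      exact hp ⟨fun i ↦ (hall i).1, fun i ↦ (hall i).2⟩
    obtain ⟨i, hi⟩ := h4
    have h5 := sum_add_pos_of_pos (fun i ↦ sq_nonneg (p.1 i)) (fun i ↦ sq_nonneg (p.2 i)) 1 hi
    have h6 := sum_add_pos_of_pos (fun i ↦ smoothTransition.nonneg (p.1 i ^ 2 - 1))
      (fun i ↦ smoothTransition.nonneg (p.2 i ^ 2 - 1)) 0 (i := i)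
      (hi.imp (fun h ↦ smoothTransition.pos_of_pos (by linarith))
        (fun h ↦ smoothTransition.pos_of_pos (by linarith)))
    have h7 := smoothTransition.pos_of_pos h6
    unfold boxLevel at h
    rw [smoothTransition.one_of_one_le h5.le] at h
    linarith
  · rintro ⟨h1, h2⟩
    have h3 : ∑ i, (smoothTransition (p.1 i ^ 2 - 1) + smoothTransition (p.2 i ^ 2 - 1)) = 0 :=
      Finset.sum_eq_zero fun i _ ↦ by
        rw [smoothTransition.zero_of_nonpos (by linarith [h1 i]),
          smoothTransition.zero_of_nonpos (by linarith [h2 i]), add_zero]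
    rw [boxLevel, h3, smoothTransition.zero, add_zero]
    exact smoothTransition.le_one _

theorem hasCompactSupport_fderiv_boxLevel (m : ℕ) :
    HasCompactSupport (fderiv ℝ (boxLevel m)) := by
  refine HasCompactSupport.intro (isCompact_closedBall (0 : (Fin m → ℝ) × (Fin m → ℝ)) 2)
    fun p hp ↦ ?_
  have h1 : boxLevel m =ᶠ[nhds p] fun _ ↦ 2 := by
    filter_upwards [Metric.isClosed_closedBall.isOpen_compl.mem_nhds hp] with q hq
    have h4 : ∃ i, 2 < |q.1 i| ∨ 2 < |q.2 i| := by
      by_contra! hall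
      refine hq (mem_closedBall_zero_iff.2 (norm_prod_le_iff.2 ⟨?_, ?_⟩))
      · exact (pi_norm_le_iff_of_nonneg zero_le_two).2 fun i ↦ (hall i).1
      · exact (pi_norm_le_iff_of_nonneg zero_le_two).2 fun i ↦ (hall i).2
    have hsq : ∀ x : ℝ, 2 < |x| → 2 < x ^ 2 := fun x hx ↦ by
      rw [← sq_abs]
      nlinarith
    obtain ⟨i, hi⟩ := h4
    have h5 := sum_add_pos_of_pos (fun i ↦ sq_nonneg (q.1 i)) (fun i ↦ sq_nonneg (q.2 i)) 1
      (i := i) (hi.imp (fun h ↦ by linarith [hsq _ h]) (fun h ↦ by linarith [hsq _ h]))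
    have h6 : 1 ≤ ∑ i, (smoothTransition (q.1 i ^ 2 - 1) + smoothTransition (q.2 i ^ 2 - 1)) := by
      refine le_trans ?_ (Finset.single_le_sum (fun j _ ↦ add_nonneg
        (smoothTransition.nonneg _) (smoothTransition.nonneg _)) (Finset.mem_univ i))
      rcases hi with h | h
      · rw [smoothTransition.one_of_one_le (by linarith [hsq _ h])]
        linarith [smoothTransition.nonneg (q.2 i ^ 2 - 1)]
      · rw [smoothTransition.one_of_one_le (x := q.2 i ^ 2 - 1) (by linarith [hsq _ h])]
        linarith [smoothTransition.nonneg (q.1 i ^ 2 - 1)]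
    rw [boxLevel, smoothTransition.one_of_one_le h5.le, smoothTransition.one_of_one_le h6]
    norm_num
  rw [h1.fderiv_eq]
  simp

end LevelFunction

section StraighteningChart

open Function

theorem eq_zero_of_wcan_eq_zero (m : ℕ) {u : EE m} (h : ∀ v, wcan m u v = 0) : u = 0 := by
  have h1 := h (0, 1, 0)
  have h2 := h (0, 0, 1)
  have h3 := fun i ↦ h ((0, Pi.single i 1), 0, 0)
  have h4 := fun i ↦ h ((Pi.single i 1, 0), 0, 0)
  simp only [wcan, wB_single_right, wB_single_left, mul_zero, sub_zero, add_zero, mul_one]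
    at h1 h2 h3 h4
  have h5 : wB m u.1 0 = 0 := by simp [wB]
  rw [h5] at h1 h2
  refine Prod.ext (Prod.ext (funext h3) (funext fun i ↦ neg_eq_zero.1 (h4 i)))
    (Prod.ext ?_ ?_)
  · simpa using h2
  · simpa using h1

/-- A set is excised by the time-one flow of a Hamiltonian as soon as there is a symplectic
embedding `Θ` of the whole space which straightens the flow to translations along `(0, 1, 0)`, has
backward-invariant image, and for which the set consists of the points leaving the image by
time one. -/
theorem hamiltonian_excisable_of_straightening (m : ℕ) {Z : Set (EE m)} {Θ : EE m → EE m}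
    (hΘ : ContDiff ℝ (⊤ : ℕ∞) Θ) (hinj : Injective Θ)
    (hsymp : ∀ z u v, wcan m (fderiv ℝ Θ z u) (fderiv ℝ Θ z v) = wcan m u v)
    (hback : ∀ w ∈ range Θ, ∀ r : ℝ, 0 ≤ r → w - r • ((0, 1, 0) : EE m) ∈ range Θ)
    (hZ : ∀ z, z ∉ Z ↔ Θ z + (0, 1, 0) ∈ range Θ) :
    ∃ F : EE m → ℝ, ContDiff ℝ (⊤ : ℕ∞) F ∧
    ∃ X : EE m → EE m,
      (∀ z w, wcan m (X z) w = fderiv ℝ F z w) ∧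
      (∀ (γ : ℝ → EE m) (T : ℝ), 0 ≤ T → γ 0 ∈ Z →
        (∀ t ∈ Icc 0 T, HasDerivAt γ (X (γ t)) t) → ∀ t ∈ Icc 0 T, γ t ∈ Z) ∧
      ∃ φ : EE m → EE m,
        (∀ z ∉ Z, ∃ γ : ℝ → EE m, γ 0 = z ∧
          (∀ t ∈ Icc (0:ℝ) 1, HasDerivAt γ (X (γ t)) t) ∧ γ 1 = φ z) ∧
        ContDiffOn ℝ (⊤ : ℕ∞) φ Zᶜ ∧
        BijOn φ Zᶜ univ ∧
        (∃ ψ : EE m → EE m, ContDiff ℝ (⊤ : ℕ∞) ψ ∧ InvOn ψ φ Zᶜ univ) ∧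
        (∀ z ∉ Z, ∀ u v,
          wcan m (fderiv ℝ φ z u) (fderiv ℝ φ z v) = wcan m u v) := by
  set d : EE m := (0, 1, 0) with hd
  have hΘd : Differentiable ℝ Θ := hΘ.differentiable (by simp)
  have hker : ∀ z, Injective (fderiv ℝ Θ z) := fun z ↦ by
    refine (injective_iff_map_eq_zero _).2 fun u hu ↦ eq_zero_of_wcan_eq_zero m fun v ↦ ?_
    rw [← hsymp z, hu]
    simp [wcan, wB]
  let L : ∀ _ : EE m, EE m ≃L[ℝ] EE m := fun z ↦
    (LinearEquiv.ofInjectiveEndo (fderiv ℝ Θ z : EE m →ₗ[ℝ] EE m) (hker z)).toContinuousLinearEquiv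
  have hL : ∀ z, (L z : EE m →L[ℝ] EE m) = fderiv ℝ Θ z := fun z ↦
    ContinuousLinearMap.ext fun _ ↦ rfl
  have hopen : IsOpen (range Θ) :=
    (isOpenMap_of_hasStrictFDerivAt_equiv (f' := L) fun z ↦ by
      rw [hL]
      exact hΘ.contDiffAt.hasStrictFDerivAt (by simp)).isOpen_range
  set G := invFun Θ with hG
  have hGΘ : ∀ z, G (Θ z) = z := leftInverse_invFun hinj
  have hΘG : ∀ w ∈ range Θ, Θ (G w) = w := by
    rintro _ ⟨z, rfl⟩
    rw [hGΘ]
  have hGs : ∀ w ∈ range Θ, ContDiffAt ℝ (⊤ : ℕ∞) G w := by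
    rintro _ ⟨z, rfl⟩
    exact contDiffAt_of_leftInvOn isOpen_univ (fun z _ ↦ hGΘ z) (mem_univ z) hΘ.contDiffAt
      (f' := L z) (by rw [hL]; exact (hΘd z).hasFDerivAt)
  have hGd : ∀ w ∈ range Θ, DifferentiableAt ℝ G w := fun w hw ↦
    (hGs w hw).differentiableAt (by simp)
  have hDG : ∀ z w, fderiv ℝ Θ z (fderiv ℝ G (Θ z) w) = w := fun z w ↦ by
    have h1 : HasFDerivAt (Θ ∘ G) ((fderiv ℝ Θ (G (Θ z))).comp (fderiv ℝ G (Θ z))) (Θ z) :=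
      (hΘd _).hasFDerivAt.comp _ (hGd _ (mem_range_self z)).hasFDerivAt
    have h2 : (Θ ∘ G) =ᶠ[nhds (Θ z)] id := by
      filter_upwards [hopen.mem_nhds (mem_range_self z)] with w hw using hΘG w hw
    have h3 := congrArg (fun A : EE m →L[ℝ] EE m ↦ A w)
      (h1.unique ((hasFDerivAt_id _).congr_of_eventuallyEq h2))
    rw [hGΘ] at h3
    exact h3
  have hseg : ∀ z ∉ Z, ∀ t ≤ (1 : ℝ), Θ z + t • d ∈ range Θ := fun z hz t ht ↦ by
    convert hback _ ((hZ z).1 hz) (1 - t) (by linarith) using 1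
    module
  have hline : ∀ (w : EE m) (t : ℝ), HasDerivAt (fun r : ℝ ↦ w + r • d) d t := fun w t ↦ by
    simpa using ((hasDerivAt_id t).smul_const d).const_add w
  have hψΘ : ∀ w, Θ (G (Θ w - d)) = Θ w - d := fun w ↦ hΘG _ (by
    simpa using hback _ (mem_range_self w) 1 zero_le_one)
  have hφΘ : ∀ z ∉ Z, Θ (G (Θ z + d)) = Θ z + d := fun z hz ↦ hΘG _ ((hZ z).1 hz)
  have hinv : InvOn (fun w ↦ G (Θ w - d)) (fun z ↦ G (Θ z + d)) Zᶜ univ := by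
    constructor
    · intro z hz
      simp only [hφΘ z hz, add_sub_cancel_right, hGΘ]
    · intro w _
      simp only [hψΘ, sub_add_cancel, hGΘ]
  have hsmooth : ∀ z ∉ Z, ContDiffAt ℝ (⊤ : ℕ∞) (fun z ↦ G (Θ z + d)) z := fun z hz ↦
    ContDiffAt.comp z (hGs _ ((hZ z).1 hz)) (hΘ.contDiffAt.add contDiffAt_const)
  refine ⟨fun z ↦ (Θ z).2.2, contDiff_snd.comp (contDiff_snd.comp hΘ),
    fun z ↦ fderiv ℝ G (Θ z) d, fun z w ↦ ?_, fun γ T _ h0 hγ t ht ↦ ?_,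
    fun z ↦ G (Θ z + d), fun z hz ↦ ⟨fun t ↦ G (Θ z + t • d), ?_, fun t ht ↦ ?_, ?_⟩,
    fun z hz ↦ (hsmooth z hz).contDiffWithinAt, hinv.bijOn (mapsTo_univ _ _) fun w _ ↦ ?_,
    ⟨fun w ↦ G (Θ w - d), contDiff_iff_contDiffAt.2 fun w ↦ ?_, hinv⟩, fun z hz u v ↦ ?_⟩
  · rw [← hsymp z, hDG, ((hΘd z).hasFDerivAt.snd.snd).fderiv]
    simp [hd, wcan, wB]
  · have h1 : Θ (γ t) = Θ (γ 0) + t • d := by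
      refine eq_of_has_deriv_right_eq (a := 0) (b := T) (f' := fun _ ↦ d) (f := Θ ∘ γ)
        (g := fun r ↦ Θ (γ 0) + r • d)
        (fun r hr ↦ ?_) (fun r _ ↦ (hline _ r).hasDerivWithinAt) (fun r hr ↦ ?_)
        (fun r _ ↦ (hline _ r).continuousAt.continuousWithinAt) (by simp) t ht
      · have h2 := (hΘd _).hasFDerivAt.comp_hasDerivAt r (hγ r (Ico_subset_Icc_self hr))
        rw [hDG] at h2
        exact h2.hasDerivWithinAt
      · exact ((hΘd _).continuousAt.comp (hγ r hr).continuousAt).continuousWithinAt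
    by_contra hz
    refine (hZ _).2 ?_ h0
    convert hseg _ hz (1 - t) (by linarith [ht.1]) using 1
    rw [h1]
    module
  · simp [hGΘ]
  · have h1 := hseg z hz t ht.2
    have h2 := (hGd _ h1).hasFDerivAt.comp_hasDerivAt t (hline (Θ z) t)
    simp only [hΘG _ h1]
    exact h2
  · simp
  · show G (Θ w - d) ∉ Z
    rw [hZ, hψΘ, sub_add_cancel]
    exact mem_range_self w
  · refine ContDiffAt.comp w (hGs _ ?_) (hΘ.contDiffAt.sub contDiffAt_const)
    rw [← hψΘ]
    exact mem_range_self _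
  · have h1 : HasFDerivAt (fun z ↦ Θ (G (Θ z + d)))
        ((fderiv ℝ Θ (G (Θ z + d))).comp (fderiv ℝ (fun z ↦ G (Θ z + d)) z)) z :=
      (hΘd _).hasFDerivAt.comp z ((hsmooth z hz).differentiableAt (by simp)).hasFDerivAt
    have hZo : IsOpen Zᶜ := by
      have : Zᶜ = (fun z ↦ Θ z + d) ⁻¹' range Θ := ext fun z ↦ hZ z
      rw [this]
      exact hopen.preimage (hΘ.continuous.add continuous_const)
    have h2 : (fun z ↦ Θ (G (Θ z + d))) =ᶠ[nhds z] fun z ↦ Θ z + d := by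
      filter_upwards [hZo.mem_nhds hz] with z hz using hφΘ z hz
    have h3 := h1.unique (((hΘd z).hasFDerivAt.add_const d).congr_of_eventuallyEq h2)
    have h4 : ∀ u, fderiv ℝ Θ (G (Θ z + d)) (fderiv ℝ (fun z ↦ G (Θ z + d)) z u) =
        fderiv ℝ Θ z u := fun u ↦ congrArg (fun A : EE m →L[ℝ] EE m ↦ A u) h3
    rw [← hsymp (G (Θ z + d)), h4, h4, hsymp]

end StraighteningChart

section GeneratingFunctionChart

/-- The real solution `c` of the cubic equation `w * c + c ^ 3 / 3 = y`, for `0 < w`. -/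
def cubicRoot (w y : ℝ) : ℝ :=
  2 * √w * Real.sinh (Real.arsinh (3 * y / (2 * (w * √w))) / 3)

theorem cubicRoot_spec {w : ℝ} (hw : 0 < w) (y : ℝ) :
    w * cubicRoot w y + cubicRoot w y ^ 3 / 3 = y := by
  have h1 : 0 < √w := Real.sqrt_pos.2 hw
  have h2 : √w ^ 2 = w := Real.sq_sqrt hw.le
  have h3 := Real.sinh_three_mul (Real.arsinh (3 * y / (2 * (w * √w))) / 3)
  rw [mul_div_cancel₀ _ (three_ne_zero), Real.sinh_arsinh, div_eq_iff (by positivity)] at h3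
  unfold cubicRoot
  set r := √w
  rw [← h2] at h3 ⊢
  linear_combination -h3 / 3

theorem eq_of_cubic_eq {w e e' : ℝ} (hw : 0 < w) (h : w * e + e ^ 3 / 3 = w * e' + e' ^ 3 / 3) :
    e = e' := by
  have h1 : (e - e') * (w + (e ^ 2 + e * e' + e' ^ 2) / 3) = 0 := by linear_combination h
  have h2 : w + (e ^ 2 + e * e' + e' ^ 2) / 3 ≠ 0 := by
    nlinarith [sq_nonneg (e + e'), sq_nonneg (e - e')]
  exact sub_eq_zero.1 ((mul_eq_zero.1 h1).resolve_right h2)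

theorem cubicRoot_eq_iff {w : ℝ} (hw : 0 < w) (y e : ℝ) :
    cubicRoot w y = e ↔ y = w * e + e ^ 3 / 3 :=
  ⟨fun h ↦ h ▸ (cubicRoot_spec hw y).symm,
    fun h ↦ eq_of_cubic_eq hw ((cubicRoot_spec hw y).trans h)⟩

theorem ContDiff.cubicRoot {E : Type*} [NormedAddCommGroup E] [NormedSpace ℝ E] {w y : E → ℝ}
    (hw : ContDiff ℝ (⊤ : ℕ∞) w) (hy : ContDiff ℝ (⊤ : ℕ∞) y) (hpos : ∀ x, 0 < w x) :
    ContDiff ℝ (⊤ : ℕ∞) fun x ↦ cubicRoot (w x) (y x) := by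
  have h1 : ContDiff ℝ (⊤ : ℕ∞) fun x ↦ √(w x) := hw.sqrt fun x ↦ (hpos x).ne'
  have h2 : ∀ x, 2 * (w x * √(w x)) ≠ 0 := fun x ↦ by
    have := hpos x
    have := Real.sqrt_pos.2 this
    positivity
  exact (contDiff_const.mul h1).mul (Real.contDiff_sinh.comp (((Real.contDiff_arsinh.comp
    ((contDiff_const.mul hy).div (contDiff_const.mul (hw.mul h1)) h2))).div_const 3))

/-- The last coordinate of `generatingChart`. -/
def chartHeight {m : ℕ} (A : ℝ × ℝ → ℝ) (s : (Fin m → ℝ) × (Fin m → ℝ) → ℝ) (z : EE m) : ℝ :=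
  cubicRoot (fderiv ℝ A (s z.1, z.2.1) (0, 1)) z.2.2

/-- The transformation of `ℝ^{2n}` with generating function `e * A (s, x) + e ^ 3 / 3 * x`,
where the variable `s` is implemented by a Hamiltonian `s` with flow `σ`. -/
def generatingChart {m : ℕ} (A : ℝ × ℝ → ℝ) (s : (Fin m → ℝ) × (Fin m → ℝ) → ℝ)
    (σ : ℝ × ((Fin m → ℝ) × (Fin m → ℝ)) → (Fin m → ℝ) × (Fin m → ℝ)) (z : EE m) : EE m :=
  (σ (chartHeight A s z * fderiv ℝ A (s z.1, z.2.1) (1, 0), z.1),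
    A (s z.1, z.2.1) + chartHeight A s z ^ 2 * z.2.1, chartHeight A s z)

variable {m : ℕ} {A : ℝ × ℝ → ℝ} {s : (Fin m → ℝ) × (Fin m → ℝ) → ℝ}
  {σ : ℝ × ((Fin m → ℝ) × (Fin m → ℝ)) → (Fin m → ℝ) × (Fin m → ℝ)}

theorem strictMono_add_mul (hA : ContDiff ℝ (⊤ : ℕ∞) A) (hpos : ∀ r, 0 < fderiv ℝ A r (0, 1))
    (σ : ℝ) {k : ℝ} (hk : 0 ≤ k) : StrictMono fun x ↦ A (σ, x) + k * x := by
  have h1 : ∀ x, HasDerivAt (fun x ↦ A (σ, x) + k * x) (fderiv ℝ A (σ, x) (0, 1) + k * 1) x :=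
    fun x ↦ ((hA.differentiable (by simp) (σ, x)).hasFDerivAt.comp_hasDerivAt x
      ((hasDerivAt_const x σ).prodMk (hasDerivAt_id x))).add ((hasDerivAt_id x).const_mul k)
  refine strictMono_of_deriv_pos fun x ↦ ?_
  rw [(h1 x).deriv]
  linarith [hpos (σ, x)]

theorem contDiff_chartHeight (hA : ContDiff ℝ (⊤ : ℕ∞) A) (hpos : ∀ r, 0 < fderiv ℝ A r (0, 1))
    (hs : ContDiff ℝ (⊤ : ℕ∞) s) : ContDiff ℝ (⊤ : ℕ∞) (chartHeight A s) := by
  have h1 : ContDiff ℝ (⊤ : ℕ∞) fun z : EE m ↦ (s z.1, z.2.1) :=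
    (hs.comp contDiff_fst).prodMk contDiff_snd.fst
  exact ((((hA.fderiv_right (m := (⊤ : ℕ∞)) (by simp)).clm_apply contDiff_const).comp
    h1).cubicRoot contDiff_snd.snd fun _ ↦ hpos _)

theorem contDiff_generatingChart (hA : ContDiff ℝ (⊤ : ℕ∞) A)
    (hpos : ∀ r, 0 < fderiv ℝ A r (0, 1)) (hs : ContDiff ℝ (⊤ : ℕ∞) s)
    (hσ : ContDiff ℝ (⊤ : ℕ∞) σ) : ContDiff ℝ (⊤ : ℕ∞) (generatingChart A s σ) := by
  have h1 : ContDiff ℝ (⊤ : ℕ∞) fun z : EE m ↦ (s z.1, z.2.1) :=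
    (hs.comp contDiff_fst).prodMk contDiff_snd.fst
  have h2 := contDiff_chartHeight hA hpos hs
  have h3 : ContDiff ℝ (⊤ : ℕ∞) fun z : EE m ↦ fderiv ℝ A (s z.1, z.2.1) ((1 : ℝ), (0 : ℝ)) :=
    ((hA.fderiv_right (m := (⊤ : ℕ∞)) (by simp)).clm_apply contDiff_const).comp h1
  exact (hσ.comp ((h2.mul h3).prodMk contDiff_fst)).prodMk
    (((hA.comp h1).add ((h2.pow 2).mul contDiff_snd.fst)).prodMk h2)

theorem chartHeight_spec (hpos : ∀ r, 0 < fderiv ℝ A r (0, 1)) (z : EE m) :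
    fderiv ℝ A (s z.1, z.2.1) (0, 1) * chartHeight A s z + chartHeight A s z ^ 3 / 3 = z.2.2 :=
  cubicRoot_spec (hpos _) _

theorem wcan_fderiv_generatingChart (hA : ContDiff ℝ (⊤ : ℕ∞) A)
    (hpos : ∀ r, 0 < fderiv ℝ A r (0, 1)) (hs : ContDiff ℝ (⊤ : ℕ∞) s)
    (hσ : ContDiff ℝ (⊤ : ℕ∞) σ) (hσs : ∀ t p, s (σ (t, p)) = s p)
    (hσt : ∀ z w, wB m (fderiv ℝ σ z (1, 0)) w = fderiv ℝ s (σ z) w)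
    (hσw : ∀ z a b, wB m (fderiv ℝ σ z (0, a)) (fderiv ℝ σ z (0, b)) = wB m a b)
    (z u v : EE m) :
    wcan m (fderiv ℝ (generatingChart A s σ) z u) (fderiv ℝ (generatingChart A s σ) z v) =
      wcan m u v := by
  have hsd : Differentiable ℝ s := hs.differentiable (by simp)
  have hσd : Differentiable ℝ σ := hσ.differentiable (by simp)
  have hAd : Differentiable ℝ A := hA.differentiable (by simp)
  have hA2d : Differentiable ℝ (fderiv ℝ A) :=
    (hA.fderiv_right (m := (⊤ : ℕ∞)) (by simp)).differentiable (by simp)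
  have hed : Differentiable ℝ (chartHeight A s) :=
    (contDiff_chartHeight hA hpos hs).differentiable (by simp)
  set ρ : ℝ × ℝ := (s z.1, z.2.1) with hρdef
  set e := chartHeight A s z with he
  set D := fderiv ℝ (fderiv ℝ A) ρ with hD
  let ρ' : EE m →L[ℝ] ℝ × ℝ :=
    ((fderiv ℝ s z.1).comp (ContinuousLinearMap.fst ℝ _ _)).prod
      ((ContinuousLinearMap.fst ℝ ℝ ℝ).comp (ContinuousLinearMap.snd ℝ _ _))
  have hρ : HasFDerivAt (fun z : EE m ↦ (s z.1, z.2.1)) ρ' z :=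
    ((hsd z.1).hasFDerivAt.comp z hasFDerivAt_fst).prodMk (hasFDerivAt_snd.fst)
  have hρ' : ∀ u, ρ' u = fderiv ℝ s z.1 u.1 • ((1 : ℝ), (0 : ℝ)) + u.2.1 • ((0 : ℝ), (1 : ℝ)) :=
    fun u ↦ by simp [ρ']
  have hDρ : ∀ u c, D (ρ' u) c = fderiv ℝ s z.1 u.1 * D (1, 0) c + u.2.1 * D (0, 1) c :=
    fun u c ↦ by
      rw [hρ', map_add, map_smul, map_smul]
      rfl
  have hpart : ∀ c : ℝ × ℝ, HasFDerivAt (fun z : EE m ↦ fderiv ℝ A (s z.1, z.2.1) c)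
      ((ContinuousLinearMap.apply ℝ ℝ c).comp (D.comp ρ')) z := fun c ↦
    (ContinuousLinearMap.apply ℝ ℝ c).hasFDerivAt.comp z
      (HasFDerivAt.comp z (hA2d ρ).hasFDerivAt hρ)
  have hAz : HasFDerivAt (fun z : EE m ↦ A (s z.1, z.2.1)) ((fderiv ℝ A ρ).comp ρ') z :=
    HasFDerivAt.comp z (hAd ρ).hasFDerivAt hρ
  have hez := (hed z).hasFDerivAt
  have hx : HasFDerivAt (fun z : EE m ↦ z.2.1)
      ((ContinuousLinearMap.fst ℝ ℝ ℝ).comp (ContinuousLinearMap.snd ℝ _ _)) z :=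
    hasFDerivAt_snd.fst
  have hsymm : D (0, 1) (1, 0) = D (1, 0) (0, 1) :=
    (hA.contDiffAt.isSymmSndFDerivAt minSmoothness_two_le) _ _
  have hB := hez.mul (hpart (1, 0))
  have hτ := hAz.add ((hez.pow 2).mul hx)
  have hΘ := ((hσd _).hasFDerivAt.comp z (hB.prodMk hasFDerivAt_fst)).prodMk (hτ.prodMk hez)
  have hΘ' : HasFDerivAt (generatingChart A s σ) _ z := hΘ
  have hY : ∀ u : EE m, u.2.2 = e * (fderiv ℝ s z.1 u.1 * D (1, 0) (0, 1) + u.2.1 * D (0, 1) (0, 1))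
      + (fderiv ℝ A ρ (0, 1) + e ^ 2) * fderiv ℝ (chartHeight A s) z u := fun u ↦ by
    have h1 := ((hpart (0, 1)).mul hez).add ((hez.pow 3).mul_const (3⁻¹ : ℝ))
    have h2 : HasFDerivAt (fun z : EE m ↦ z.2.2)
        ((ContinuousLinearMap.snd ℝ ℝ ℝ).comp (ContinuousLinearMap.snd ℝ _ _)) z :=
      hasFDerivAt_snd.snd
    have h3 : (fun z : EE m ↦ z.2.2) = fun z : EE m ↦
        fderiv ℝ A (s z.1, z.2.1) (0, 1) * chartHeight A s z + chartHeight A s z ^ 3 * 3⁻¹ :=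
      funext fun z ↦ by rw [← chartHeight_spec (A := A) (s := s) hpos z]; ring
    rw [h3] at h2
    have h4 := congrArg (fun A : EE m →L[ℝ] ℝ ↦ A u) (h2.unique h1)
    simp only [ContinuousLinearMap.comp_apply, ContinuousLinearMap.coe_snd', add_apply, smul_apply,
      ContinuousLinearMap.apply_apply, hDρ, smul_eq_mul, nsmul_eq_mul] at h4
    rw [h4, ← hρdef, ← he]
    norm_num
    ring
  have hsσ : ∀ q w, fderiv ℝ s (σ q) (fderiv ℝ σ q (0, w)) = fderiv ℝ s q.2 w := fun q w ↦ by
    have h1 : HasFDerivAt (fun q ↦ s (σ q)) _ q := (hsd _).hasFDerivAt.comp q (hσd q).hasFDerivAt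
    have h2 : (fun q : ℝ × _ ↦ s (σ q)) = fun q ↦ s q.2 := funext fun q ↦ hσs q.1 q.2
    rw [h2] at h1
    have h3 : HasFDerivAt (fun q : ℝ × ((Fin m → ℝ) × (Fin m → ℝ)) ↦ s q.2) _ q :=
      (hsd q.2).hasFDerivAt.comp q hasFDerivAt_snd
    exact congrArg (fun A : _ →L[ℝ] ℝ ↦ A ((0 : ℝ), w)) (h1.unique h3)
  set q : ℝ × ((Fin m → ℝ) × (Fin m → ℝ)) := (e * fderiv ℝ A ρ (1, 0), z.1) with hq
  set e' := fderiv ℝ (chartHeight A s) z with he'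
  let b : EE m → ℝ := fun u ↦ e * (fderiv ℝ s z.1 u.1 * D (1, 0) (1, 0) +
    u.2.1 * D (0, 1) (1, 0)) + fderiv ℝ A ρ (1, 0) * e' u
  let t : EE m → ℝ := fun u ↦ fderiv ℝ s z.1 u.1 * fderiv ℝ A ρ (1, 0) +
    u.2.1 * fderiv ℝ A ρ (0, 1) + (e ^ 2 * u.2.1 + z.2.1 * (2 * e * e' u))
  have hΘu : ∀ u, fderiv ℝ (generatingChart A s σ) z u =
      (b u • fderiv ℝ σ q (1, 0) + fderiv ℝ σ q (0, u.1), t u, e' u) := fun u ↦ by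
    rw [hΘ'.fderiv]
    refine Prod.ext ?_ (Prod.ext ?_ rfl)
    · rw [← map_smul, ← map_add]
      refine congrArg (fderiv ℝ σ q) ?_
      refine Prod.ext ?_ (by simp)
      simp [hDρ, b, he, hρdef]
    · simp only [ContinuousLinearMap.prod_apply, add_apply, smul_apply,
        ContinuousLinearMap.comp_apply, hρ', map_add, map_smul, smul_eq_mul, nsmul_eq_mul, t]
      norm_num [he]
  have hform : ∀ u v, wB m (b u • fderiv ℝ σ q (1, 0) + fderiv ℝ σ q (0, u.1))
      (b v • fderiv ℝ σ q (1, 0) + fderiv ℝ σ q (0, v.1)) =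
      b u * fderiv ℝ s z.1 v.1 - b v * fderiv ℝ s z.1 u.1 + wB m u.1 v.1 := fun u v ↦ by
    rw [← wBL_apply]
    simp only [map_add, map_smul, add_apply, smul_apply, smul_eq_mul, wBL_apply]
    rw [hσw, wB_self, wB_neg_comm m (fderiv ℝ σ q (0, u.1)), hσt, hσt, hsσ, hsσ]
    ring
  simp only [wcan, hΘu, hform, hY u, hY v]
  simp only [b, t, hsymm]
  ring

theorem generatingChart_injective (hA : ContDiff ℝ (⊤ : ℕ∞) A)
    (hpos : ∀ r, 0 < fderiv ℝ A r (0, 1)) (h0 : ∀ p, σ (0, p) = p)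
    (hadd : ∀ t u p, σ (t + u, p) = σ (t, σ (u, p))) (hσs : ∀ t p, s (σ (t, p)) = s p) :
    Function.Injective (generatingChart A s σ) := by
  intro z z' h
  have h1 := congrArg (fun z : EE m ↦ z.1) h
  have h2 := congrArg (fun z : EE m ↦ z.2.1) h
  have h3 := congrArg (fun z : EE m ↦ z.2.2) h
  simp only [generatingChart] at h1 h2 h3
  have h4 := congrArg s h1
  rw [hσs, hσs] at h4
  have h5 : z.2.1 = z'.2.1 := by
    rw [h3, h4] at h2
    exact (strictMono_add_mul hA hpos (s z'.1) (sq_nonneg _)).injective h2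
  have h6 : z.1 = z'.1 := by
    rw [h3, h4, h5] at h1
    rw [← h0 z.1, ← h0 z'.1, ← neg_add_cancel, hadd, h1, ← hadd]
  refine Prod.ext h6 (Prod.ext h5 ?_)
  rw [← chartHeight_spec (A := A) (s := s) hpos z, ← chartHeight_spec (A := A) (s := s) hpos z',
    h3, h4, h5]

theorem mem_range_generatingChart (hpos : ∀ r, 0 < fderiv ℝ A r (0, 1))
    (h0 : ∀ p, σ (0, p) = p) (hadd : ∀ t u p, σ (t + u, p) = σ (t, σ (u, p)))
    (hσs : ∀ t p, s (σ (t, p)) = s p) (w : EE m) :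
    w ∈ range (generatingChart A s σ) ↔ ∃ x, A (s w.1, x) + w.2.2 ^ 2 * x = w.2.1 := by
  constructor
  · rintro ⟨z, rfl⟩
    refine ⟨z.2.1, ?_⟩
    simp only [generatingChart, hσs]
  · rintro ⟨x, hx⟩
    obtain ⟨q, τ, e⟩ := w
    simp only at hx
    set r := -(e * fderiv ℝ A (s q, x) (1, 0)) with hr
    refine ⟨(σ (r, q), x, fderiv ℝ A (s q, x) (0, 1) * e + e ^ 3 / 3), ?_⟩
    have h1 : chartHeight A s
        (σ (r, q), x, fderiv ℝ A (s q, x) (0, 1) * e + e ^ 3 / 3) = e := by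
      simp only [chartHeight, hσs]
      exact (cubicRoot_eq_iff (hpos _) _ _).2 rfl
    simp only [generatingChart, h1, hσs, hx, ← hadd]
    rw [hr, add_neg_cancel, h0]

end GeneratingFunctionChart

section TailProfile

open Real Filter Topology

/-- The time function along the rays `{(σ, x) : x ∈ ℝ}`. Its supremum is `exp (-1)` for `σ = 0`,
is `1` for `0 < σ ≤ 1`, and is infinite for `1 < σ`. -/
def tailProfile (r : ℝ × ℝ) : ℝ :=
  exp (-1) * (1 - exp (-r.2)) +
    (1 - exp (-1)) * (r.1 ^ 2 * (exp r.2 - 1) / (r.1 ^ 2 * exp r.2 + 1)) +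
    expNegInvGlue (r.1 - 1) * r.2

theorem sq_mul_exp_add_one_pos (σ x : ℝ) : 0 < σ ^ 2 * exp x + 1 := by positivity

theorem one_sub_exp_neg_one_pos : 0 < 1 - exp (-1) := by
  simp

theorem contDiff_tailProfile : ContDiff ℝ (⊤ : ℕ∞) tailProfile := by
  have h1 : ContDiff ℝ (⊤ : ℕ∞) fun r : ℝ × ℝ ↦ exp r.2 := contDiff_exp.comp contDiff_snd
  have h2 : ContDiff ℝ (⊤ : ℕ∞) fun r : ℝ × ℝ ↦ exp (-r.2) := contDiff_exp.comp contDiff_snd.neg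
  have h3 : ContDiff ℝ (⊤ : ℕ∞) fun r : ℝ × ℝ ↦ r.1 ^ 2 := contDiff_fst.pow 2
  refine ((contDiff_const.mul (contDiff_const.sub h2)).add (contDiff_const.mul
    ((h3.mul (h1.sub contDiff_const)).div ((h3.mul h1).add contDiff_const) fun r ↦
      (sq_mul_exp_add_one_pos _ _).ne'))).add (ContDiff.mul ?_ contDiff_snd)
  exact expNegInvGlue.contDiff.comp (contDiff_fst.sub contDiff_const)

theorem fderiv_tailProfile_pos (r : ℝ × ℝ) : 0 < fderiv ℝ tailProfile r (0, 1) := by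
  obtain ⟨σ, x⟩ := r
  have h1 : HasDerivAt (fun x ↦ tailProfile (σ, x)) (fderiv ℝ tailProfile (σ, x) (0, 1)) x :=
    (contDiff_tailProfile.differentiable (by simp) (σ, x)).hasFDerivAt.comp_hasDerivAt x
      ((hasDerivAt_const x σ).prodMk (hasDerivAt_id x))
  have hne := (sq_mul_exp_add_one_pos σ x).ne'
  have h2 : HasDerivAt (fun x ↦ tailProfile (σ, x)) _ x :=
    (((((hasDerivAt_neg x).exp.const_sub 1).const_mul (exp (-1))).add
      (((((hasDerivAt_exp x).sub_const 1).const_mul (σ ^ 2)).div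
        (((hasDerivAt_exp x).const_mul (σ ^ 2)).add_const 1) hne).const_mul (1 - exp (-1)))).add
      ((hasDerivAt_id x).const_mul (expNegInvGlue (σ - 1))))
  rw [h1.unique h2]
  have h3 := expNegInvGlue.nonneg (σ - 1)
  have h4 := one_sub_exp_neg_one_pos
  have h5 : σ ^ 2 * exp x * (σ ^ 2 * exp x + 1) - σ ^ 2 * (exp x - 1) * (σ ^ 2 * exp x) =
    σ ^ 2 * exp x * (1 + σ ^ 2) := by ring
  rw [h5, mul_neg_one, neg_neg, mul_one]
  positivity

theorem tailProfile_zero (x : ℝ) : tailProfile (0, x) = exp (-1) * (1 - exp (-x)) := by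
  simp [tailProfile, expNegInvGlue.zero_of_nonpos]

theorem mul_le_tailProfile (σ : ℝ) {x : ℝ} (hx : 0 ≤ x) :
    expNegInvGlue (σ - 1) * x ≤ tailProfile (σ, x) := by
  have h1 := one_sub_exp_neg_one_pos
  have h2 : 0 ≤ 1 - exp (-x) := by simpa using hx
  have h3 : 0 ≤ exp x - 1 := by simpa using hx
  have h4 : 0 ≤ exp (-1) * (1 - exp (-x)) + (1 - exp (-1)) *
    (σ ^ 2 * (exp x - 1) / (σ ^ 2 * exp x + 1)) := by positivity
  simpa only [tailProfile, le_add_iff_nonneg_left] using h4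

theorem tailProfile_le_mul (σ : ℝ) {x : ℝ} (hx : x ≤ 0) :
    tailProfile (σ, x) ≤ exp (-1) * x := by
  have h1 := one_sub_exp_neg_one_pos
  have h2 : 1 - exp (-x) ≤ x := by linarith [add_one_le_exp (-x)]
  have h3 : σ ^ 2 * (exp x - 1) / (σ ^ 2 * exp x + 1) ≤ 0 :=
    div_nonpos_of_nonpos_of_nonneg
      (mul_nonpos_of_nonneg_of_nonpos (sq_nonneg σ) (by simpa using hx))
      (sq_mul_exp_add_one_pos σ x).le
  have h4 := mul_le_mul_of_nonneg_left h2 (exp_pos (-1)).le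
  have h5 := mul_nonpos_of_nonneg_of_nonpos h1.le h3
  have h6 := mul_nonpos_of_nonneg_of_nonpos (expNegInvGlue.nonneg (σ - 1)) hx
  simp only [tailProfile]
  linarith

theorem tailProfile_eq_of_le_one {σ : ℝ} (hσ : σ ≤ 1) (x : ℝ) :
    tailProfile (σ, x) = exp (-1) * (1 - exp (-x)) +
      (1 - exp (-1)) * (1 - (σ ^ 2 + 1) / (σ ^ 2 * exp x + 1)) := by
  have := (sq_mul_exp_add_one_pos σ x).ne'
  simp only [tailProfile, expNegInvGlue.zero_of_nonpos (sub_nonpos.2 hσ), zero_mul, add_zero]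
  congr 2
  field_simp
  ring

theorem tailProfile_lt_one {σ : ℝ} (hσ : σ ≤ 1) (x : ℝ) : tailProfile (σ, x) < 1 := by
  rw [tailProfile_eq_of_le_one hσ]
  have h1 : 0 < exp (-1) * exp (-x) := by positivity
  have h2 : 0 ≤ (1 - exp (-1)) * ((σ ^ 2 + 1) / (σ ^ 2 * exp x + 1)) :=
    mul_nonneg one_sub_exp_neg_one_pos.le (by positivity)
  linarith

theorem tendsto_tailProfile {σ : ℝ} (h0 : σ ≠ 0) (hσ : σ ≤ 1) :
    Tendsto (fun x ↦ tailProfile (σ, x)) atTop (𝓝 1) := by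
  have h1 : Tendsto (fun x ↦ (σ ^ 2 + 1) / (σ ^ 2 * exp x + 1)) atTop (𝓝 0) :=
    Tendsto.div_atTop tendsto_const_nhds (tendsto_atTop_add_const_right _ _
      (tendsto_exp_atTop.const_mul_atTop (by positivity)))
  have h2 := ((tendsto_exp_neg_atTop_nhds_zero.const_sub 1).const_mul (exp (-1))).add
    ((h1.const_sub 1).const_mul (1 - exp (-1)))
  simp only [tailProfile_eq_of_le_one hσ]
  convert h2 using 2
  ring

theorem tendsto_tailProfile_zero :
    Tendsto (fun x ↦ tailProfile (0, x)) atTop (𝓝 (exp (-1))) := by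
  simp only [tailProfile_zero]
  simpa using (tendsto_exp_neg_atTop_nhds_zero.const_sub 1).const_mul (exp (-1))

theorem exists_tailProfile_eq_of_le {σ k t x : ℝ} (hk : 0 ≤ k)
    (h : t ≤ tailProfile (σ, x) + k * x) : ∃ x, tailProfile (σ, x) + k * x = t := by
  have hc : Continuous fun x ↦ tailProfile (σ, x) + k * x :=
    (contDiff_tailProfile.continuous.comp (by fun_prop)).add (by fun_prop)
  have h1 : tailProfile (σ, min 0 (t / exp (-1))) + k * min 0 (t / exp (-1)) ≤ t := by
    have h2 := tailProfile_le_mul σ (min_le_left 0 (t / exp (-1)))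
    have h3 := mul_nonpos_of_nonneg_of_nonpos hk (min_le_left 0 (t / exp (-1)))
    have h4 := mul_le_mul_of_nonneg_left (min_le_right 0 (t / exp (-1))) (exp_pos (-1)).le
    rw [mul_div_cancel₀ _ (exp_pos _).ne'] at h4
    linarith
  exact mem_range_of_exists_le_of_exists_ge hc ⟨_, h1⟩ ⟨_, h⟩

theorem exists_le_tailProfile {σ k : ℝ} (h : 0 < expNegInvGlue (σ - 1) + k) (t : ℝ) :
    ∃ x, t ≤ tailProfile (σ, x) + k * x := by
  refine ⟨max 0 (t / (expNegInvGlue (σ - 1) + k)), ?_⟩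
  have h1 := mul_le_tailProfile σ (le_max_left 0 (t / (expNegInvGlue (σ - 1) + k)))
  have h2 := mul_le_mul_of_nonneg_left (le_max_right 0 (t / (expNegInvGlue (σ - 1) + k))) h.le
  rw [mul_div_cancel₀ _ h.ne'] at h2
  linarith

theorem exists_tailProfile_eq_add_one_iff {σ k x : ℝ} (hk : 0 ≤ k) :
    (∃ x', tailProfile (σ, x') + k * x' = tailProfile (σ, x) + k * x + 1) ↔
      ¬(k = 0 ∧ (σ ≤ 1 ∧ 0 ≤ x ∨ σ = 0 ∧ -1 ≤ x)) := by
  have hexp : exp (-1) * exp 1 = 1 := by rw [← exp_add]; simp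
  constructor
  · rintro ⟨x', h⟩ ⟨rfl, ⟨hσ, hx⟩ | ⟨rfl, hx⟩⟩
    · have h1 := mul_le_tailProfile σ hx
      have h2 := mul_nonneg (expNegInvGlue.nonneg (σ - 1)) hx
      linarith [tailProfile_lt_one hσ x']
    · rw [tailProfile_zero, tailProfile_zero] at h
      have h1 : exp (-1) * exp (-x) ≤ exp (-1) * exp 1 :=
        mul_le_mul_of_nonneg_left (exp_le_exp.2 (by linarith)) (exp_pos _).le
      have h2 : 0 < exp (-1) * exp (-x') := by positivity
      linarith
  · intro h
    have hβ := expNegInvGlue.nonneg (σ - 1)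
    suffices h' : ∃ x', tailProfile (σ, x) + k * x + 1 ≤ tailProfile (σ, x') + k * x' from
      h'.elim fun x' hx' ↦ exists_tailProfile_eq_of_le hk hx'
    by_cases hk0 : 0 < expNegInvGlue (σ - 1) + k
    · exact exists_le_tailProfile hk0 _
    obtain rfl : k = 0 := by linarith
    have hσ : σ ≤ 1 := by
      by_contra! hσ
      exact hk0 (by simpa using expNegInvGlue.pos_of_pos (sub_pos.2 hσ))
    simp only [true_and, not_or, not_and, hσ, not_le] at h
    simp only [zero_mul, add_zero]
    by_cases h0 : σ = 0
    · subst h0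
      refine ((tendsto_tailProfile_zero.eventually_const_lt ?_).exists).imp fun _ ↦ le_of_lt
      rw [tailProfile_zero]
      have h1 : exp (-1) * exp 1 < exp (-1) * exp (-x) :=
        mul_lt_mul_of_pos_left (exp_lt_exp.2 (by linarith [h.2 rfl])) (exp_pos _)
      linarith
    · refine (((tendsto_tailProfile h0 hσ).eventually_const_lt ?_).exists).imp fun _ ↦ le_of_lt
      have h1 := tailProfile_le_mul σ h.1.le
      have h2 := mul_neg_of_pos_of_neg (exp_pos (-1)) h.1
      linarith

end TailProfile

theorem mem_boxWithTail_iff (m : ℕ) (z : EE m) :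
    z ∈ boxWithTail m ↔ z.2.2 = 0 ∧
      (boxLevel m z.1 ≤ 1 ∧ 0 ≤ z.2.1 ∨ boxLevel m z.1 = 0 ∧ -1 ≤ z.2.1) := by
  simp only [boxWithTail, mem_union, mem_ofPred_eq, boxLevel_le_one_iff, boxLevel_eq_zero_iff]
  tauto

/-- The "box with a tail" is time-independent Hamiltonian excisable from
`(ℝ^{2n}, ω_can)` for `n ≥ 2`. -/
theorem boxWithTail_timeIndependent_hamiltonian_excisable (m : ℕ) (hm : 1 ≤ m) :
    ∃ F : EE m → ℝ, ContDiff ℝ (⊤ : ℕ∞) F ∧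
    ∃ X : EE m → EE m,
      (∀ z w, wcan m (X z) w = fderiv ℝ F z w) ∧
      (∀ (γ : ℝ → EE m) (T : ℝ), 0 ≤ T → γ 0 ∈ boxWithTail m →
        (∀ t ∈ Icc 0 T, HasDerivAt γ (X (γ t)) t) →
        ∀ t ∈ Icc 0 T, γ t ∈ boxWithTail m) ∧
      ∃ φ : EE m → EE m,
        (∀ z ∉ boxWithTail m, ∃ γ : ℝ → EE m, γ 0 = z ∧
          (∀ t ∈ Icc (0:ℝ) 1, HasDerivAt γ (X (γ t)) t) ∧ γ 1 = φ z) ∧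
        ContDiffOn ℝ (⊤ : ℕ∞) φ (boxWithTail m)ᶜ ∧
        BijOn φ (boxWithTail m)ᶜ univ ∧
        (∃ ψ : EE m → EE m, ContDiff ℝ (⊤ : ℕ∞) ψ ∧ InvOn ψ φ (boxWithTail m)ᶜ univ) ∧
        (∀ z ∉ boxWithTail m, ∀ u v,
          wcan m (fderiv ℝ φ z u) (fderiv ℝ φ z v) = wcan m u v) := by
  obtain ⟨σ, hσ, h0, hadd, hσs, hσt, hσw⟩ :=
    exists_hamiltonian_flow m (contDiff_boxLevel m) (hasCompactSupport_fderiv_boxLevel m)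
  have hrange := mem_range_generatingChart fderiv_tailProfile_pos h0 hadd hσs
  refine hamiltonian_excisable_of_straightening m
    (Θ := generatingChart tailProfile (boxLevel m) σ)
    (contDiff_generatingChart contDiff_tailProfile fderiv_tailProfile_pos (contDiff_boxLevel m) hσ)
    (generatingChart_injective contDiff_tailProfile fderiv_tailProfile_pos h0 hadd hσs)
    (wcan_fderiv_generatingChart contDiff_tailProfile fderiv_tailProfile_pos
      (contDiff_boxLevel m) hσ hσs hσt hσw) (fun w hw r hr ↦ ?_) fun z ↦ ?_
  · obtain ⟨x, hx⟩ := (hrange w).1 hw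
    refine (hrange _).2 ?_
    simp only [Prod.fst_sub, Prod.snd_sub, Prod.smul_fst, Prod.smul_snd, smul_zero,
      smul_eq_mul, mul_one, mul_zero, sub_zero]
    exact exists_tailProfile_eq_of_le (sq_nonneg _) ((sub_le_self _ hr).trans hx.ge)
  · rw [hrange, mem_boxWithTail_iff]
    simp only [generatingChart, Prod.fst_add, Prod.snd_add, add_zero, hσs]
    rw [exists_tailProfile_eq_add_one_iff (sq_nonneg _), sq_eq_zero_iff, chartHeight,
      cubicRoot_eq_iff (fderiv_tailProfile_pos _)]
    simp
end
end
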